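/- arXiv:1409.2229 — 4 statements merged into one kernel-verified Lean document; each statement's English description precedes it below -/
import Mathlib

section
/- Let k ≥ 4 be an integer, let ι be an integer with 2 ≤ ι ≤ k−2, and let S = {y = a + bᶦx^{k−ᶦ}} ⊂ ℝ⁴. Then the real Lie algebra 𝒜(S) of infinitesimal multicontact automorphisms of S is exactly the 4-dimensional linear span of the vector fields V_{−k} = ∂_a + ∂_y, V₀ = x∂_x + ky∂_y + ka∂_a + b∂_b, V₀′ = ιx∂_x + (ι−k)b∂_b, and V_k = a²∂_a + (1/ι)ab∂_b + (1/(k−ι))xy∂_x + y²∂_y. -/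
/-- Tangency to `S = {y = a + P(x,b)}` of the para-holomorphic vector field
`ξ(x,y)∂_x + η(x,y)∂_y + α(a,b)∂_a + β(a,b)∂_b` on `ℝ⁴` (coordinates `(x,y,a,b)`):
`α + β·∂_bP + ξ·∂_xP − η = 0` whenever `y = a + P(x,b)`. -/
def TangentVF (P : ℝ → ℝ → ℝ) (ξ η α β : ℝ × ℝ → ℝ) : Prop :=
  ∀ x a b : ℝ,
    α (a, b) + β (a, b) * deriv (fun t => P x t) b
      + ξ (x, a + P x b) * deriv (fun t => P t b) x
      - η (x, a + P x b) = 0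

/-- The elementary functional equation. -/
lemma funeq (f B X : ℝ → ℝ)
    (h : ∀ a y, a < y → f y - f a = (y - a) * (B a + X y)) :
    ∃ f0 B0 X0 c : ℝ, (∀ a, B a = B0 + c * a) ∧ (∀ y, X y = X0 + c * y) ∧
      ∀ y, f y = f0 + (B0 + X0) * y + c * y ^ 2 := by
  have h3 : ∀ a y z, a < y → y < z →
      (z - y) * (B a - B y) + (y - a) * (X z - X y) = 0 := by
    intro a y z h1 h2
    have e1 := h a y h1
    have e2 := h y z h2
    have e3 := h a z (h1.trans h2)
    linarith
  -- slope of `X` to the right of `y`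
  have hXs : ∀ y z, y < z → X z - X y = (z - y) * (B y - B (y - 1)) := by
    intro y z hz
    have := h3 (y - 1) y z (by linarith) hz
    linarith
  have hBs : ∀ a y, a < y → B y - B a = (y - a) * (X (y + 1) - X y) := by
    intro a y hz
    have := h3 a y (y + 1) hz (by linarith)
    linarith
  set s : ℝ → ℝ := fun y => B y - B (y - 1) with hs
  have hsc : ∀ y z, y < z → s y = s z := by
    intro y z hz
    have e1 := hXs y z hz
    have e2 := hXs z (z + 1) (by linarith)
    have e3 := hXs y (z + 1) (by linarith)
    simp only [hs]
    linarith
  have hs0 : ∀ y, s y = s 0 := by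
    intro y
    rcases lt_trichotomy y 0 with h1 | h1 | h1
    · exact hsc _ _ h1
    · rw [h1]
    · exact (hsc _ _ h1).symm
  have hX : ∀ y, X y = X 0 + s 0 * y := by
    intro y
    rcases lt_trichotomy y 0 with h1 | h1 | h1
    · have e := hXs y 0 h1
      have e' := hs0 y
      simp only [hs] at e' ⊢
      rw [e'] at e
      linarith
    · rw [h1]; ring
    · have e := hXs 0 y h1
      simp only [hs]
      linarith
  have hB : ∀ y, B y = B 0 + s 0 * y := by
    intro y
    rcases lt_trichotomy y 0 with h1 | h1 | h1
    · have e := hBs y 0 h1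
      rw [hX (0 + 1), hX 0] at e
      linarith
    · rw [h1]; ring
    · have e := hBs 0 y h1
      rw [hX (y + 1), hX y] at e
      linarith
  refine ⟨f 0, B 0, X 0, s 0, hB, hX, ?_⟩
  intro y
  rcases lt_trichotomy y 0 with h1 | h1 | h1
  · have e := h y 0 h1
    rw [hB y] at e
    linarith
  · rw [h1]; ring
  · have e := h 0 y h1
    rw [hX y] at e
    linarith

/-- Reduction to the functional equation. -/
lemma core (n m : ℕ) (hn : 2 ≤ n) (hm : 2 ≤ m) (ξ η α β : ℝ × ℝ → ℝ)
    (hξ : AnalyticOnNhd ℝ ξ Set.univ) (hη : AnalyticOnNhd ℝ η Set.univ)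
    (hβ : AnalyticOnNhd ℝ β Set.univ)
    (H : ∀ x a b : ℝ, α (a, b) + β (a, b) * ((n : ℝ) * b ^ (n - 1) * x ^ m)
      + ξ (x, a + b ^ n * x ^ m) * (b ^ n * ((m : ℝ) * x ^ (m - 1)))
      - η (x, a + b ^ n * x ^ m) = 0) :
    ∃ f0 B0 X0 c : ℝ, (∀ a b, α (a, b) = f0 + (B0 + X0) * a + c * a ^ 2) ∧
      (∀ x y, η (x, y) = f0 + (B0 + X0) * y + c * y ^ 2) ∧
      (∀ a b, n * β (a, b) = b * (B0 + c * a)) ∧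
      (∀ x y, m * ξ (x, y) = x * (X0 + c * y)) := by
  have hn0 : n ≠ 0 := by omega
  have hm0 : m ≠ 0 := by omega
  have hn1 : n - 1 ≠ 0 := by omega
  have hm1 : m - 1 ≠ 0 := by omega
  have hnR : (n : ℝ) ≠ 0 := by exact_mod_cast hn0
  have hmR : (m : ℝ) ≠ 0 := by exact_mod_cast hm0
  set f : ℝ → ℝ := fun y => η (0, y) with hf
  have hα : ∀ a b, α (a, b) = f a := by
    intro a b
    have := H 0 a b
    simp [hm0, hm1] at this
    simp only [hf]; linarith
  have hηf : ∀ x y, η (x, y) = f y := by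
    intro x y
    have := H x y 0
    simp [hn0, hn1] at this
    rw [hα] at this; linarith
  have hfd : Differentiable ℝ f := by
    intro y
    have h1 : DifferentiableAt ℝ η (0, y) := (hη _ (Set.mem_univ _)).differentiableAt
    exact h1.comp y ((differentiableAt_const _).prodMk differentiableAt_id)
  have hbn : ∀ b : ℝ, b ^ n = b * b ^ (n - 1) := fun b => by
    rw [← pow_succ']; congr 1; omega
  have hxm : ∀ x : ℝ, x ^ m = x * x ^ (m - 1) := fun x => by
    rw [← pow_succ']; congr 1; omega
  -- basic equation, divided
  have E : ∀ x a b : ℝ, x ≠ 0 → b ≠ 0 →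
      x * b * (f (a + b ^ n * x ^ m) - f a) = b ^ n * x ^ m *
        (x * (n * β (a, b)) + b * (m * ξ (x, a + b ^ n * x ^ m))) := by
    intro x a b hx hb
    have h1 := H x a b
    rw [hα, hηf] at h1
    have h2 : f (a + b ^ n * x ^ m) - f a = β (a, b) * ((n : ℝ) * b ^ (n - 1) * x ^ m)
      + ξ (x, a + b ^ n * x ^ m) * (b ^ n * ((m : ℝ) * x ^ (m - 1))) := by linarith
    rw [h2]
    generalize ξ (x, a + b ^ n * x ^ m) = Z
    rw [hbn b, hxm x]
    ring
  have E2 : ∀ x a b : ℝ, x ≠ 0 → b ≠ 0 →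
      x * b * dslope f a (a + b ^ n * x ^ m) =
        (x * (n * β (a, b)) + b * (m * ξ (x, a + b ^ n * x ^ m))) := by
    intro x a b hx hb
    have ht : b ^ n * x ^ m ≠ 0 := mul_ne_zero (pow_ne_zero _ hb) (pow_ne_zero _ hx)
    have h1 := E x a b hx hb
    have h2 := sub_smul_dslope f a (a + b ^ n * x ^ m)
    rw [← h2, smul_eq_mul, add_sub_cancel_left] at h1
    apply mul_left_cancel₀ ht
    linarith
  have hcurve : ∀ a b : ℝ, HasDerivAt (fun x : ℝ => ((x, a + b ^ n * x ^ m) : ℝ × ℝ))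
      ((1, 0) : ℝ × ℝ) 0 := by
    intro a b
    refine (hasDerivAt_id (0 : ℝ)).prodMk ?_
    have := ((hasDerivAt_pow m (0 : ℝ)).const_mul (b ^ n)).const_add a
    simpa [hm1] using this
  have hcurve0 : ∀ a b : ℝ, ((0, a + b ^ n * (0:ℝ) ^ m) : ℝ × ℝ) = (0, a) := by
    intro a b; simp [hm0]
  have hξd : ∀ a b : ℝ, HasDerivAt (fun x : ℝ => ξ (x, a + b ^ n * x ^ m))
      (fderiv ℝ ξ (0, a) (1, 0)) 0 := by
    intro a b
    have h1 : HasFDerivAt ξ (fderiv ℝ ξ (0, a)) ((0, a + b ^ n * (0:ℝ) ^ m) : ℝ × ℝ) := by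
      rw [hcurve0]
      exact (hξ _ (Set.mem_univ _)).differentiableAt.hasFDerivAt
    exact h1.comp_hasDerivAt (0 : ℝ) (hcurve a b)
  have hDc : ∀ a b : ℝ, ContinuousAt (fun x : ℝ => dslope f a (a + b ^ n * x ^ m)) 0 := by
    intro a b
    have h1 : ContinuousAt (dslope f a) (a + b ^ n * (0:ℝ) ^ m) := by
      simp only [ne_eq, hm0, not_false_eq_true, zero_pow, mul_zero, add_zero]
      exact continuousAt_dslope_same.2 (hfd a)
    exact ContinuousAt.comp (f := fun x : ℝ => a + b ^ n * x ^ m) h1 (by fun_prop)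
  have hξ0 : ∀ a, ξ (0, a) = 0 := by
    intro a
    have hc1 : ContinuousAt (fun x : ℝ => x * 1 * dslope f a (a + 1 ^ n * x ^ m)) 0 :=
      (continuousAt_id.mul continuousAt_const).mul (hDc a 1)
    have hc2 : ContinuousAt (fun x : ℝ => x * (n * β (a, 1)) +
        1 * (m * ξ (x, a + 1 ^ n * x ^ m))) 0 := by
      have := (hξd a 1).continuousAt
      exact (continuousAt_id.mul continuousAt_const).add
        (continuousAt_const.mul (continuousAt_const.mul this))
    have he : (fun x : ℝ => x * 1 * dslope f a (a + 1 ^ n * x ^ m)) =ᶠ[nhdsWithin 0 {0}ᶜ]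
        (fun x : ℝ => x * (n * β (a, 1)) + 1 * (m * ξ (x, a + 1 ^ n * x ^ m))) := by
      filter_upwards [self_mem_nhdsWithin] with x hx
      exact E2 x a 1 hx one_ne_zero
    have h1 := hc1.tendsto.mono_left (nhdsWithin_le_nhds (s := {0}ᶜ))
    have h2 := hc2.tendsto.mono_left (nhdsWithin_le_nhds (s := {0}ᶜ))
    have h3 := tendsto_nhds_unique (h1.congr' he) h2
    simpa [hm0, hmR] using h3
  set B : ℝ → ℝ := fun a => deriv f a - m * fderiv ℝ ξ (0, a) (1, 0) with hB
  have hβ1 : ∀ a b, b ≠ 0 → n * β (a, b) = b * B a := by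
    intro a b hb
    have h1 : Filter.Tendsto (fun x : ℝ => b * dslope f a (a + b ^ n * x ^ m))
        (nhdsWithin 0 {0}ᶜ) (nhds (b * deriv f a)) := by
      have := (hDc a b).tendsto.mono_left (nhdsWithin_le_nhds (s := {0}ᶜ))
      simp [hm0, dslope_same] at this
      exact this.const_mul b
    have h2 : Filter.Tendsto (fun x : ℝ => n * β (a, b) + b * (m *
        (x⁻¹ * ξ (x, a + b ^ n * x ^ m))))
        (nhdsWithin 0 {0}ᶜ) (nhds (n * β (a, b) + b * (m * fderiv ℝ ξ (0, a) (1, 0)))) := by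
      have := (hasDerivAt_iff_tendsto_slope.1 (hξd a b))
      refine ((Filter.Tendsto.congr ?_ this).const_mul (m : ℝ)).const_mul b |>.const_add _
      intro x
      simp [slope_def_field, hm0, hξ0]
      ring
    have he : (fun x : ℝ => b * dslope f a (a + b ^ n * x ^ m)) =ᶠ[nhdsWithin 0 {0}ᶜ]
        (fun x : ℝ => n * β (a, b) + b * (m * (x⁻¹ * ξ (x, a + b ^ n * x ^ m)))) := by
      filter_upwards [self_mem_nhdsWithin] with x hx
      have hx : x ≠ 0 := hx
      have := E2 x a b hx hb
      generalize ξ (x, a + b ^ n * x ^ m) = Z at *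
      field_simp
      linarith
    have h3 := tendsto_nhds_unique (h1.congr' he) h2
    simp only [hB]
    linarith
  have hβ2 : ∀ a b, n * β (a, b) = b * B a := by
    intro a
    have hA : AnalyticOnNhd ℝ (fun b : ℝ => n * β (a, b)) Set.univ := by
      intro b _
      exact analyticAt_const.mul ((hβ (a, b) (Set.mem_univ _)).comp₂ analyticAt_const analyticAt_id)
    have hA' : AnalyticOnNhd ℝ (fun b : ℝ => b * B a) Set.univ := fun b _ =>
      analyticAt_id.mul analyticAt_const
    have := hA.eq_of_eventuallyEq hA' (z₀ := 1) (by
      filter_upwards [isOpen_Ioi.mem_nhds (show (1:ℝ) ∈ Set.Ioi 0 by simp)] with b hb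
      exact hβ1 a b (ne_of_gt hb))
    intro b
    exact congrFun this b
  -- positive x
  have E3 : ∀ x a y : ℝ, 0 < x → a < y →
      x * (f y - f a) = (y - a) * (x * B a + m * ξ (x, y)) := by
    intro x a y hx hay
    obtain ⟨b, hb, hbe⟩ : ∃ b : ℝ, 0 < b ∧ b ^ n = (y - a) / x ^ m := by
      have hp : 0 < (y - a) / x ^ m := div_pos (by linarith) (pow_pos hx _)
      exact ⟨((y - a) / x ^ m) ^ ((n : ℝ)⁻¹), Real.rpow_pos_of_pos hp _,
        Real.rpow_inv_natCast_pow hp.le hn0⟩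
    have ht : b ^ n * x ^ m = y - a := by
      rw [hbe]; field_simp
    have h1 := E x a b hx.ne' hb.ne'
    rw [ht, hβ2, add_sub_cancel] at h1
    apply mul_left_cancel₀ hb.ne'
    linarith
  set X : ℝ → ℝ := fun y => m * ξ (1, y) with hX
  have hF : ∀ a y, a < y → f y - f a = (y - a) * (B a + X y) := by
    intro a y h
    have := E3 1 a y one_pos h
    simp only [hX]
    linarith
  have hξ1 : ∀ y x, 0 < x → m * ξ (x, y) = x * X y := by
    intro y x hx
    have h1 := E3 x (y - 1) y hx (by linarith)
    rw [hF (y - 1) y (by linarith)] at h1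
    linarith
  have hξ2 : ∀ y x, m * ξ (x, y) = x * X y := by
    intro y
    have hA : AnalyticOnNhd ℝ (fun x : ℝ => m * ξ (x, y)) Set.univ := by
      intro x _
      exact analyticAt_const.mul ((hξ (x, y) (Set.mem_univ _)).comp₂ analyticAt_id analyticAt_const)
    have hA' : AnalyticOnNhd ℝ (fun x : ℝ => x * X y) Set.univ := fun b _ =>
      analyticAt_id.mul analyticAt_const
    have := hA.eq_of_eventuallyEq hA' (z₀ := 1) (by
      filter_upwards [isOpen_Ioi.mem_nhds (show (1:ℝ) ∈ Set.Ioi 0 by simp)] with x hx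
      exact hξ1 y x hx)
    intro x
    exact congrFun this x
  obtain ⟨f0, B0, X0, c, h1, h2, h3⟩ := funeq f B X hF
  refine ⟨f0, B0, X0, c, ?_, ?_, ?_, ?_⟩
  · intro a b; rw [hα, h3]
  · intro x y; rw [hηf, h3]
  · intro a b; rw [hβ2, h1]
  · intro x y; rw [hξ2, h2]

/-- for `k ≥ 4`, `2 ≤ ι ≤ k−2` and `S = {y = a + bᶥ x^{k-ι}}`, the
Lie algebra `𝒜(S)` of infinitesimal multicontact automorphisms (real-analytic
para-holomorphic vector fields tangent to `S`) is exactly the 4-dimensional span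
of `V₋ₖ = ∂_a + ∂_y`, `V₀ = x∂_x + ky∂_y + ka∂_a + b∂_b`,
`V₀′ = ιx∂_x + (ι−k)b∂_b` and
`V_k = a²∂_a + (1/ι)ab∂_b + (1/(k−ι))xy∂_x + y²∂_y`. -/
theorem stmt_8
    (k ι : ℕ) (hk : 4 ≤ k) (hι₁ : 2 ≤ ι) (hι₂ : ι ≤ k - 2)
    (P : ℝ → ℝ → ℝ) (hP : P = fun x b => b ^ ι * x ^ (k - ι))
    (W : Fin 4 → ((ℝ × ℝ × ℝ × ℝ) → ℝ × ℝ × ℝ × ℝ))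
    (hW : W = ![fun _ => ((0 : ℝ), (1 : ℝ), (1 : ℝ), (0 : ℝ)),
      fun q => (q.1, (k : ℝ) * q.2.1, (k : ℝ) * q.2.2.1, q.2.2.2),
      fun q => ((ι : ℝ) * q.1, 0, 0, ((ι : ℝ) - (k : ℝ)) * q.2.2.2),
      fun q => (1 / ((k : ℝ) - (ι : ℝ)) * (q.1 * q.2.1), q.2.1 ^ 2,
        q.2.2.1 ^ 2, 1 / (ι : ℝ) * (q.2.2.1 * q.2.2.2))]) :
    LinearIndependent ℝ W ∧
    ∀ ξ η α β : ℝ × ℝ → ℝ,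
      AnalyticOnNhd ℝ ξ Set.univ → AnalyticOnNhd ℝ η Set.univ →
      AnalyticOnNhd ℝ α Set.univ → AnalyticOnNhd ℝ β Set.univ →
      (TangentVF P ξ η α β ↔
        ∃ c : Fin 4 → ℝ,
          (fun q : ℝ × ℝ × ℝ × ℝ =>
              ((ξ (q.1, q.2.1), η (q.1, q.2.1),
                α (q.2.2.1, q.2.2.2), β (q.2.2.1, q.2.2.2)) : ℝ × ℝ × ℝ × ℝ))
            = fun q => ∑ i, c i • W i q) := by
  obtain ⟨m, rfl⟩ : ∃ m, k = ι + m := ⟨k - ι, by omega⟩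
  have hm : 2 ≤ m := by omega
  have hsub : ι + m - ι = m := by omega
  rw [hsub] at hP
  have hnR : (ι : ℝ) ≠ 0 := by
    have : ι ≠ 0 := by omega
    exact_mod_cast this
  have hmR : (m : ℝ) ≠ 0 := by
    have : m ≠ 0 := by omega
    exact_mod_cast this
  have hkR : (ι : ℝ) + m ≠ 0 := by
    have : ι + m ≠ 0 := by omega
    exact_mod_cast this
  have hT : ∀ ξ η α β : ℝ × ℝ → ℝ, TangentVF P ξ η α β ↔
      ∀ x a b : ℝ, α (a, b) + β (a, b) * ((ι : ℝ) * b ^ (ι - 1) * x ^ m)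
      + ξ (x, a + b ^ ι * x ^ m) * (b ^ ι * ((m : ℝ) * x ^ (m - 1)))
      - η (x, a + b ^ ι * x ^ m) = 0 := by
    intro ξ η α β
    have d1 : ∀ x b : ℝ, deriv (fun t => t ^ ι * x ^ m) b = (ι : ℝ) * b ^ (ι - 1) * x ^ m :=
      fun x b => ((hasDerivAt_pow ι b).mul_const (x ^ m)).deriv
    have d2 : ∀ x b : ℝ, deriv (fun t => b ^ ι * t ^ m) x = b ^ ι * ((m : ℝ) * x ^ (m - 1)) :=
      fun x b => ((hasDerivAt_pow m x).const_mul (b ^ ι)).deriv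
    simp only [TangentVF, hP, d1, d2]
  constructor
  · rw [Fintype.linearIndependent_iff]
    intro g hg
    have hq : ∀ q, g 0 • W 0 q + g 1 • W 1 q + g 2 • W 2 q + g 3 • W 3 q = 0 := by
      intro q
      have := congrFun hg q
      simpa [Fin.sum_univ_four] using this
    have q0 := hq (0, 0, 0, 0)
    have q1 := hq (1, 1, 0, 0)
    have q2 := hq (1, -1, 0, 0)
    simp [hW] at q0 q1 q2
    obtain ⟨q1a, q1b⟩ := q1
    obtain ⟨q2a, q2b⟩ := q2
    have e1 : g 1 = 0 := by
      have : ((ι : ℝ) + m) * g 1 = 0 := by linarith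
      exact (mul_eq_zero.1 this).resolve_left hkR
    have e3 : g 3 = 0 := by
      rw [e1] at q1b; linarith
    have e2 : g 2 = 0 := by
      rw [e1, e3] at q1a
      have : (ι : ℝ) * g 2 = 0 := by linarith
      exact (mul_eq_zero.1 this).resolve_left hnR
    intro i
    fin_cases i
    · exact q0
    · exact e1
    · exact e2
    · exact e3
  · intro ξ η α β hξ hη hα hβ
    rw [hT]
    constructor
    · intro H
      obtain ⟨f0, B0, X0, c, h1, h2, h3, h4⟩ := core ι m hι₁ hm ξ η α β hξ hη hβ H
      have h3' : ∀ a b, β (a, b) = b * (B0 + c * a) / ι := fun a b => by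
        rw [← h3]; field_simp
      have h4' : ∀ x y, ξ (x, y) = x * (X0 + c * y) / m := fun x y => by
        rw [← h4]; field_simp
      refine ⟨![f0, X0 / m - ι * ((X0 / m - B0 / ι) / (ι + m)),
        (X0 / m - B0 / ι) / (ι + m), c], ?_⟩
      funext q
      obtain ⟨x, y, a, b⟩ := q
      simp only [h1, h2, h3', h4', hW, Fin.sum_univ_four]
      simp
      refine ⟨?_, ?_, ?_, ?_⟩ <;> field_simp <;> ring
    · rintro ⟨c, hc⟩ x a b
      have hq : ∀ x y a b : ℝ, _ := fun x y a b => congrFun hc (x, y, a, b)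
      simp [hW, Fin.sum_univ_four] at hq
      have r1 := fun x y => (hq x y 0 0).1
      have r2 := fun x y => (hq x y 0 0).2.1
      have r3 := fun a b => (hq 0 0 a b).2.2.1
      have r4 := fun a b => (hq 0 0 a b).2.2.2
      have hbn : b ^ ι = b * b ^ (ι - 1) := by
        rw [← pow_succ']; congr 1; omega
      have hxm : x ^ m = x * x ^ (m - 1) := by
        rw [← pow_succ']; congr 1; omega
      rw [r1, r2, r3, r4, hbn, hxm]
      generalize b ^ (ι - 1) = u
      generalize x ^ (m - 1) = v
      field_simp
      ring
end

section
/- Let k > 2 be an integer and ι an integer with 1 ≤ ι ≤ k−1, and let S = {y = a + bᶦx^{k−ᶦ}} ⊂ ℝ⁴. Then the four vector fields V_{−k} = ∂_a + ∂_y, V₀ = x∂_x + ky∂_y + ka∂_a + b∂_b, V₀′ = ιx∂_x + (ι−k)b∂_b, and V_k = a²∂_a + (1/ι)ab∂_b + (1/(k−ι))xy∂_x + y²∂_y are infinitesimal multicontact automorphisms of S, are linearly independent over ℝ, their span is closed under the commutator of vector fields, and this 4-dimensional Lie algebra is isomorphic (as a real Lie algebra) to the direct sum sl(2,ℝ) ⊕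 ℝ, where sl(2,ℝ) is the Lie algebra of traceless real 2×2 matrices with the matrix commutator and ℝ is the 1-dimensional abelian Lie algebra. -/
theorem fderivLin (A B C D : ℝ) (q v : ℝ × ℝ × ℝ × ℝ) :
    fderiv ℝ (fun q : ℝ × ℝ × ℝ × ℝ => (A * q.1, B * q.2.1, C * q.2.2.1, D * q.2.2.2)) q v
      = (A * v.1, B * v.2.1, C * v.2.2.1, D * v.2.2.2) := by
  have h1 : HasFDerivAt (𝕜 := ℝ) (fun q : ℝ × ℝ × ℝ × ℝ => q.1) _ q := hasFDerivAt_fst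
  have h : HasFDerivAt (𝕜 := ℝ) (fun q : ℝ × ℝ × ℝ × ℝ => q.2) _ q := hasFDerivAt_snd
  have h2 := h.fst
  have h3 := h.snd.fst
  have h4 := h.snd.snd
  have H := (h1.const_mul A).prodMk ((h2.const_mul B).prodMk ((h3.const_mul C).prodMk
    (h4.const_mul D)))
  rw [H.fderiv]
  simp

theorem fderivQuad (A D : ℝ) (q v : ℝ × ℝ × ℝ × ℝ) :
    fderiv ℝ (fun q : ℝ × ℝ × ℝ × ℝ =>
      (A * (q.1 * q.2.1), q.2.1 ^ 2, q.2.2.1 ^ 2, D * (q.2.2.1 * q.2.2.2))) q v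
      = (A * (q.1 * v.2.1 + q.2.1 * v.1), 2 * q.2.1 * v.2.1, 2 * q.2.2.1 * v.2.2.1,
        D * (q.2.2.1 * v.2.2.2 + q.2.2.2 * v.2.2.1)) := by
  have h1 : HasFDerivAt (𝕜 := ℝ) (fun q : ℝ × ℝ × ℝ × ℝ => q.1) _ q := hasFDerivAt_fst
  have h : HasFDerivAt (𝕜 := ℝ) (fun q : ℝ × ℝ × ℝ × ℝ => q.2) _ q := hasFDerivAt_snd
  have h2 := h.fst
  have h3 := h.snd.fst
  have h4 := h.snd.snd
  have H := ((h1.mul h2).const_mul A).prodMk ((h2.pow 2).prodMk ((h3.pow 2).prodMk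
    ((h3.mul h4).const_mul D)))
  have e := H.fderiv
  simp only [Pi.mul_apply, Pi.pow_apply] at e
  rw [e]
  simp [mul_add]

/-- structure constants of the bracket -/
noncomputable def strc (k d : ℝ) : Fin 4 → Fin 4 → Fin 4 → ℝ :=
  ![![![0,0,0,0], ![k,0,0,0], ![0,0,0,0], ![0,2/k,d,0]],
    ![![-k,0,0,0], ![0,0,0,0], ![0,0,0,0], ![0,0,0,k]],
    ![![0,0,0,0], ![0,0,0,0], ![0,0,0,0], ![0,0,0,0]],
    ![![0,-(2/k),-d,0], ![0,0,0,-k], ![0,0,0,0], ![0,0,0,0]]]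

/-- The traceless matrix with rows `(p, q)`, `(s, -p)`. -/
def slm (p q s : ℝ) : ↥(LieAlgebra.SpecialLinear.sl (Fin 2) ℝ) :=
  ⟨!![p, q; s, -p], by
    change Matrix.trace !![p, q; s, -p] = 0
    simp [Matrix.trace_fin_two]⟩

theorem slm_surj (m : ↥(LieAlgebra.SpecialLinear.sl (Fin 2) ℝ)) : ∃ p q s, m = slm p q s := by
  obtain ⟨m, hm⟩ := m
  refine ⟨m 0 0, m 0 1, m 1 0, ?_⟩
  have h : Matrix.trace m = 0 := hm
  rw [Matrix.trace_fin_two] at h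
  apply Subtype.ext
  ext i j
  fin_cases i <;> fin_cases j <;> simp [slm]
  linarith

theorem slm_add (p q s p' q' s' : ℝ) :
    slm p q s + slm p' q' s' = slm (p + p') (q + q') (s + s') := by
  apply Subtype.ext
  ext i j
  fin_cases i <;> fin_cases j <;> simp [slm]
  ring

theorem slm_smul (c p q s : ℝ) :
    c • slm p q s = slm (c * p) (c * q) (c * s) := by
  apply Subtype.ext
  ext i j
  fin_cases i <;> fin_cases j <;> simp [slm]

theorem slm_lie (p q s p' q' s' : ℝ) :
    ⁅slm p q s, slm p' q' s'⁆ =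
      slm (q * s' - q' * s) (2 * (p * q' - p' * q)) (2 * (s * p' - s' * p)) := by
  apply Subtype.ext
  rw [LieAlgebra.SpecialLinear.sl_bracket]
  ext i j
  fin_cases i <;> fin_cases j <;> simp [slm, Matrix.mul_apply, Fin.sum_univ_two] <;> ring

theorem slm_inj {p q s p' q' s' : ℝ} (h : slm p q s = slm p' q' s') :
    p = p' ∧ q = q' ∧ s = s' := by
  have h' := congrArg Subtype.val h
  refine ⟨by simpa [slm] using congrFun (congrFun h' 0) 0,
    by simpa [slm] using congrFun (congrFun h' 0) 1,
    by simpa [slm] using congrFun (congrFun h' 1) 0⟩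

theorem slm_zero : slm 0 0 0 = 0 := by
  apply Subtype.ext
  ext i j
  fin_cases i <;> fin_cases j <;> simp [slm]

/-- The commutator of two vector fields on `ℝ⁴`. -/
noncomputable def VFbracket (V W : (ℝ × ℝ × ℝ × ℝ) → ℝ × ℝ × ℝ × ℝ) :
    (ℝ × ℝ × ℝ × ℝ) → ℝ × ℝ × ℝ × ℝ :=
  fun q => fderiv ℝ W q (V q) - fderiv ℝ V q (W q)

/-- for `k > 2`, `1 ≤ ι ≤ k−1` and `S = {y = a + bᶥ x^{k-ι}}`, the
four fields `V₋ₖ = ∂_a + ∂_y`, `V₀ = x∂_x + ky∂_y + ka∂_a + b∂_b`,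
`V₀′ = ιx∂_x + (ι−k)b∂_b`, `V_k = a²∂_a + (1/ι)ab∂_b + (1/(k−ι))xy∂_x + y²∂_y`
are infinitesimal multicontact automorphisms of `S`, linearly independent, their
span is closed under the commutator, and the resulting 4-dimensional Lie algebra
is isomorphic to `sl(2,ℝ) ⊕ ℝ` (the bracket of the direct sum being
`⁅(m,r),(m',r')⁆ = (⁅m,m'⁆, 0)`, `ℝ` abelian). -/
theorem stmt_9
    (k ι : ℕ) (hk : 2 < k) (hι₁ : 1 ≤ ι) (hι₂ : ι ≤ k - 1)
    (P : ℝ → ℝ → ℝ) (hP : P = fun x b => b ^ ι * x ^ (k - ι))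
    (W : Fin 4 → ((ℝ × ℝ × ℝ × ℝ) → ℝ × ℝ × ℝ × ℝ))
    (hW : W = ![fun _ => ((0 : ℝ), (1 : ℝ), (1 : ℝ), (0 : ℝ)),
      fun q => (q.1, (k : ℝ) * q.2.1, (k : ℝ) * q.2.2.1, q.2.2.2),
      fun q => ((ι : ℝ) * q.1, 0, 0, ((ι : ℝ) - (k : ℝ)) * q.2.2.2),
      fun q => (1 / ((k : ℝ) - (ι : ℝ)) * (q.1 * q.2.1), q.2.1 ^ 2,
        q.2.2.1 ^ 2, 1 / (ι : ℝ) * (q.2.2.1 * q.2.2.2))]) :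
    -- each is an infinitesimal multicontact automorphism of S
    (TangentVF P (fun _ => 0) (fun _ => 1) (fun _ => 1) (fun _ => 0) ∧
     TangentVF P (fun p => p.1) (fun p => (k : ℝ) * p.2)
       (fun p => (k : ℝ) * p.1) (fun p => p.2) ∧
     TangentVF P (fun p => (ι : ℝ) * p.1) (fun _ => 0) (fun _ => 0)
       (fun p => ((ι : ℝ) - (k : ℝ)) * p.2) ∧
     TangentVF P (fun p => 1 / ((k : ℝ) - (ι : ℝ)) * (p.1 * p.2))
       (fun p => p.2 ^ 2) (fun p => p.1 ^ 2)
       (fun p => 1 / (ι : ℝ) * (p.1 * p.2))) ∧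
    -- linearly independent
    LinearIndependent ℝ W ∧
    -- span closed under the commutator
    (∀ i j : Fin 4, ∃ c : Fin 4 → ℝ,
      VFbracket (W i) (W j) = fun q => ∑ l, c l • W l q) ∧
    -- isomorphic, as a real Lie algebra, to sl(2,ℝ) ⊕ ℝ
    (∃ φ : ((ℝ × ℝ × ℝ × ℝ) → ℝ × ℝ × ℝ × ℝ) →ₗ[ℝ]
        (↥(LieAlgebra.SpecialLinear.sl (Fin 2) ℝ) × ℝ),
      LinearIndependent ℝ (fun i => φ (W i)) ∧
      Submodule.span ℝ (Set.range fun i => φ (W i)) = ⊤ ∧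
      ∀ i j : Fin 4, φ (VFbracket (W i) (W j)) = (⁅(φ (W i)).1, (φ (W j)).1⁆, 0)) := by
  obtain ⟨n, rfl⟩ : ∃ n, k = ι + (n + 1) := ⟨k - ι - 1, by omega⟩
  obtain ⟨m, rfl⟩ : ∃ m, ι = m + 1 := ⟨ι - 1, by omega⟩
  have hsub : m + 1 + (n + 1) - (m + 1) = n + 1 := by omega
  rw [hsub] at hP
  generalize hK : ((m + 1 + (n + 1) : ℕ) : ℝ) = K at *
  generalize hI : ((m + 1 : ℕ) : ℝ) = I at *
  have hI0 : I ≠ 0 := by rw [← hI]; positivity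
  have hK0 : K ≠ 0 := by rw [← hK]; positivity
  have hKI : K - I = (n : ℝ) + 1 := by rw [← hK, ← hI]; push_cast; ring
  have hKI0 : K - I ≠ 0 := by rw [hKI]; positivity
  have hb : ∀ x b : ℝ, deriv (fun t => P x t) b = I * b ^ m * x ^ (n + 1) := by
    intro x b
    subst hP
    simp [← hI]
  have hx : ∀ x b : ℝ, deriv (fun t => P t b) x = b ^ (m + 1) * ((K - I) * x ^ n) := by
    intro x b
    subst hP
    simp [hKI]
  have hPv : ∀ x b : ℝ, P x b = b ^ (m + 1) * x ^ (n + 1) := by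
    intro x b; rw [hP]
  set d : ℝ := (2 * I - K) / (K * I * (K - I)) with hd
  have hW0 : ∀ q, W 0 q = (0, 1, 1, 0) := by intro q; rw [hW]; rfl
  have hW1 : ∀ q, W 1 q = (q.1, K * q.2.1, K * q.2.2.1, q.2.2.2) := by intro q; rw [hW]; rfl
  have hW2 : ∀ q, W 2 q = (I * q.1, 0, 0, (I - K) * q.2.2.2) := by intro q; rw [hW]; rfl
  have hW3 : ∀ q, W 3 q = (1 / (K - I) * (q.1 * q.2.1), q.2.1 ^ 2,
        q.2.2.1 ^ 2, 1 / I * (q.2.2.1 * q.2.2.2)) := by intro q; rw [hW]; rfl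
  have hF0 : ∀ q v, fderiv ℝ (W 0) q v = 0 := by
    intro q v
    rw [show W 0 = fun _ => (0, 1, 1, 0) from funext hW0]
    simp
  have hF1 : ∀ q v, fderiv ℝ (W 1) q v = (v.1, K * v.2.1, K * v.2.2.1, v.2.2.2) := by
    intro q v
    have := fderivLin 1 K K 1 q v
    simp only [one_mul] at this
    rw [← this, show W 1 = _ from funext hW1]
  have hF2 : ∀ q v, fderiv ℝ (W 2) q v = (I * v.1, 0, 0, (I - K) * v.2.2.2) := by
    intro q v
    have := fderivLin I 0 0 (I - K) q v
    simp only [zero_mul] at this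
    rw [← this, show W 2 = _ from funext hW2]
  have hF3 : ∀ q v, fderiv ℝ (W 3) q v =
      (1 / (K - I) * (q.1 * v.2.1 + q.2.1 * v.1), 2 * q.2.1 * v.2.1, 2 * q.2.2.1 * v.2.2.1,
        1 / I * (q.2.2.1 * v.2.2.2 + q.2.2.2 * v.2.2.1)) := by
    intro q v
    rw [← fderivQuad, show W 3 = _ from funext hW3]
  have hbr : ∀ i j, VFbracket (W i) (W j) = fun q => ∑ l, strc K d i j l • W l q := by
    intro i j
    funext q
    fin_cases i <;> fin_cases j <;>
      simp [VFbracket, strc, Fin.sum_univ_four, hF0, hF1, hF2, hF3, hW0, hW1, hW2, hW3, hd] <;>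
      (try refine ⟨?_, ?_, ?_, ?_⟩) <;> (try field_simp) <;> (try ring_nf) <;> (try simp)
  have hli : LinearIndependent ℝ W := by
    rw [Fintype.linearIndependent_iff]
    intro g hg
    have key : ∀ q, g 0 • W 0 q + g 1 • W 1 q + g 2 • W 2 q + g 3 • W 3 q = 0 := by
      intro q
      have := congrFun hg q
      simpa [Fin.sum_univ_four] using this
    have e0 := key (0, 0, 0, 0)
    have e1 := key (0, 1, 0, 0)
    have e2 := key (0, -1, 0, 0)
    have e3 := key (1, 0, 0, 0)
    simp [hW0, hW1, hW2, hW3] at e0 e1 e2 e3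
    have g0 : g 0 = 0 := e0
    have g1 : g 1 = 0 := by
      have : g 1 * K = 0 := by linarith [e1.1, e2.1]
      simpa [hK0] using this
    have g2 : g 2 = 0 := by
      have : g 2 * I = 0 := by linarith [e3.1]
      simpa [hI0] using this
    have g3 : g 3 = 0 := by
      rw [g0, g1] at e1; simpa using e1
    intro i
    fin_cases i <;> assumption
  refine ⟨⟨?_, ?_, ?_, ?_⟩, hli, fun i j => ⟨_, hbr i j⟩, ?_⟩
  · intro x a b; simp
  · intro x a b; simp only [hb, hx]; rw [hPv]; ring
  · intro x a b; simp only [hb, hx]; ring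
  · intro x a b; simp only [hb, hx]; rw [hPv]; field_simp; ring
  let v : Fin 4 → ↥(LieAlgebra.SpecialLinear.sl (Fin 2) ℝ) × ℝ :=
    ![(slm 0 0 1, 0), (slm (K / 2) 0 0, -(K * d / 2)), (slm 0 0 0, 1), (slm 0 (-1) 0, 0)]
  obtain ⟨φ, hφ⟩ := LinearMap.exists_extend ((Module.Basis.span hli).constr ℝ v)
  have hφW : ∀ i, φ (W i) = v i := by
    intro i
    have h := LinearMap.congr_fun hφ (Module.Basis.span hli i)
    rw [Module.Basis.constr_basis] at h
    rw [← h]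
    simp [Module.Basis.span_apply]
  have hsum : ∀ c : Fin 4 → ℝ, ∑ l, c l • v l =
      (slm (c 1 * (K / 2)) (-c 3) (c 0), c 1 * (-(K * d / 2)) + c 2) := by
    intro c
    simp [Fin.sum_univ_four, v, slm_smul, slm_add]
  have hfun : (fun i => φ (W i)) = v := funext hφW
  refine ⟨φ, ?_, ?_, ?_⟩
  · rw [hfun, Fintype.linearIndependent_iff]
    intro g hg
    rw [hsum, Prod.mk_eq_zero, ← slm_zero] at hg
    obtain ⟨h1, h2⟩ := hg
    obtain ⟨ha, hb', hc⟩ := slm_inj h1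
    have g1 : g 1 = 0 := by simpa [hK0] using ha
    have g3 : g 3 = 0 := by simpa using hb'
    have g2 : g 2 = 0 := by simpa [g1] using h2
    intro i
    fin_cases i <;> assumption
  · rw [hfun, eq_top_iff]
    rintro ⟨M, r⟩ -
    obtain ⟨p, q, s, rfl⟩ := slm_surj M
    have := hsum ![s, 2 * p / K, r + p * d, -q]
    have e : ((slm p q s, r) : ↥(LieAlgebra.SpecialLinear.sl (Fin 2) ℝ) × ℝ) =
        ∑ l, (![s, 2 * p / K, r + p * d, -q] : Fin 4 → ℝ) l • v l := by
      rw [this]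
      have e1 : 2 * p / K * (K / 2) = p := by field_simp
      have e2 : 2 * p / K * (-(K * d / 2)) + (r + p * d) = r := by
        have : 2 * p / K * (-(K * d / 2)) = -(p * d) := by
          clear_value d; field_simp
        rw [this]; ring
      simp only [Matrix.cons_val, neg_neg, e1, e2]
    rw [e]
    exact Submodule.sum_mem _ fun l _ => Submodule.smul_mem _ _ (Submodule.subset_span ⟨l, rfl⟩)
  · intro i j
    have h : VFbracket (W i) (W j) = ∑ l, strc K d i j l • W l := by
      rw [hbr]; funext q; simp [Finset.sum_apply]
    rw [h, map_sum]
    simp only [map_smul, hφW]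
    rw [hsum]
    clear_value d
    fin_cases i <;> fin_cases j <;> simp [strc, v, slm_lie, slm_zero] <;> (try field_simp) <;> (try simp)
end

section
/- Let k > 2 be an integer and let S = {y = a + (x+b)^k} ⊂ ℝ⁴. Then the real Lie algebra 𝒜(S) of infinitesimal multicontact automorphisms of S is exactly the 3-dimensional linear span of the vector fields V_{−k} = ∂_a + ∂_y, V_{−1} = ∂_b − ∂_x, and V₀ = x∂_x + ky∂_y + ka∂_a + b∂_b. -/
lemma aux_const (k : ℕ) (hk : 2 < k) (f : ℝ → ℝ)
    (h : ∀ a s : ℝ, s ≠ 0 → f (a + s ^ k) = f a) : ∀ a, f a = f 0 := by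
  have key : ∀ a b, a < b → f b = f a := by
    intro a b hab
    have hp : 0 < b - a := sub_pos.2 hab
    have := h a ((b - a) ^ ((k : ℝ)⁻¹)) (Real.rpow_pos_of_pos hp _).ne'
    rw [Real.rpow_inv_natCast_pow hp.le (by omega)] at this
    simpa using this
  intro a
  rcases lt_trichotomy a 0 with h1 | h1 | h1
  · exact (key _ _ h1).symm
  · rw [h1]
  · exact key _ _ h1

lemma aux_main (k : ℕ) (hk : 2 < k) (ξ η α β : ℝ × ℝ → ℝ)
    (hξ : Differentiable ℝ ξ) (hη : Differentiable ℝ η)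
    (hα : Differentiable ℝ α) (hβ : Differentiable ℝ β)
    (H : ∀ x a s : ℝ, α (a, s - x) + k * s ^ (k - 1) * (β (a, s - x) + ξ (x, a + s ^ k))
      = η (x, a + s ^ k)) :
    ∃ c C d : ℝ, (∀ x y, ξ (x, y) = c * x - C) ∧ (∀ x y, η (x, y) = k * c * y + d) ∧
      (∀ a b, α (a, b) = k * c * a + d) ∧ (∀ a b, β (a, b) = c * b + C) := by
  have hk0 : (k : ℝ) ≠ 0 := by positivity
  have k0 : k ≠ 0 := by omega
  have k1 : k - 1 ≠ 0 := by omega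
  have k2 : k - 1 - 1 ≠ 0 := by omega
  have hpow : HasDerivAt (fun s : ℝ => s ^ k) 0 0 := by
    simpa [k1] using hasDerivAt_pow k (0 : ℝ)
  have hpow1 : HasDerivAt (fun s : ℝ => s ^ (k - 1)) 0 0 := by
    simpa [k2] using hasDerivAt_pow (k - 1) (0 : ℝ)
  -- composition with `a + s ^ k`
  have hcomp : ∀ (f : ℝ × ℝ → ℝ), Differentiable ℝ f → ∀ x a : ℝ,
      HasDerivAt (fun s : ℝ => f (x, a + s ^ k)) 0 0 := by
    intro f hf x a
    have h1 : DifferentiableAt ℝ (fun t : ℝ => f (x, t)) (a + 0 ^ k) := by fun_prop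
    have h2 := h1.hasDerivAt.comp (0 : ℝ) (hpow.const_add a)
    simpa [Function.comp_def] using h2
  have hη0 : ∀ x a, η (x, a) = α (a, -x) := by
    intro x a
    have := H x a 0
    simp [k0, k1] at this
    exact this.symm
  -- step 1
  have hαc : ∀ a b, α (a, b) = α (a, 0) := by
    intro a b
    have hd : Differentiable ℝ (fun t : ℝ => α (a, t)) := by fun_prop
    refine is_const_of_deriv_eq_zero hd ?_ b 0
    intro t
    have h1 : HasDerivAt (fun s : ℝ => α (a, s - (-t))) (deriv (fun t : ℝ => α (a, t)) t) 0 := by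
      have := (hd (0 - (-t))).hasDerivAt.comp_sub_const 0 (-t)
      simpa using this
    have hG : DifferentiableAt ℝ (fun s : ℝ => β (a, s - (-t)) + ξ (-t, a + s ^ k)) 0 := by
      fun_prop
    have h2 := (hcomp η hη (-t) a).sub ((hpow1.const_mul (k : ℝ)).mul hG.hasDerivAt)
    have h3 : (fun s : ℝ => α (a, s - (-t))) = (fun s : ℝ => η (-t, a + s ^ k)) -
        (fun s : ℝ => (k : ℝ) * s ^ (k - 1)) *
          (fun s : ℝ => β (a, s - (-t)) + ξ (-t, a + s ^ k)) := by
      funext s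
      simp only [Pi.sub_apply, Pi.mul_apply]
      linarith [H (-t) a s]
    rw [← h3] at h2
    have := h1.unique h2
    simpa [k1] using this
  obtain ⟨A, hA⟩ : ∃ A : ℝ → ℝ, A = fun a => α (a, 0) := ⟨_, rfl⟩
  have hAd : Differentiable ℝ A := by rw [hA]; fun_prop
  have hαA : ∀ a b, α (a, b) = A a := by intro a b; rw [hαc, hA]
  have hηA : ∀ x y, η (x, y) = A y := by intro x y; rw [hη0, hαA]
  -- step 2
  have hG : ∀ x a s : ℝ, k * (β (a, s - x) + ξ (x, a + s ^ k)) = s * dslope A a (a + s ^ k) := by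
    intro x a
    have hq : Continuous (dslope A a) := by
      rw [continuous_iff_continuousAt]
      intro b
      by_cases hb : b = a
      · rw [hb]; exact continuousAt_dslope_same.2 (hAd a)
      · exact (continuousAt_dslope_of_ne hb).2 (hAd b).continuousAt
    have hβc := hβ.continuous
    have hξc := hξ.continuous
    have c1 : Continuous (fun s : ℝ => k * (β (a, s - x) + ξ (x, a + s ^ k))) := by fun_prop
    have c2 : Continuous (fun s : ℝ => s * dslope A a (a + s ^ k)) := by fun_prop
    have := c1.ext_on (dense_compl_singleton (0 : ℝ)) c2 (by
      intro s hs
      have hs : s ≠ 0 := hs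
      have h1 := sub_smul_dslope A a (a + s ^ k)
      have h2 := H x a s
      rw [hαA, hηA] at h2
      simp only [smul_eq_mul, add_sub_cancel_left] at h1
      have h3 : s ^ k = s ^ (k - 1) * s := by
        rw [← pow_succ]; congr 1; omega
      have h4 : s ^ (k - 1) ≠ 0 := pow_ne_zero _ hs
      apply mul_left_cancel₀ h4
      simp only
      calc _ = A (a + s ^ k) - A a := by linarith
        _ = s ^ k * dslope A a (a + s ^ k) := h1.symm
        _ = s ^ (k - 1) * s * dslope A a (a + s ^ k) := by rw [← h3]
        _ = _ := by ring)
    exact congrFun this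
  have hξβ : ∀ x y, ξ (x, y) = - β (y, -x) := by
    intro x y
    have := hG x y 0
    simp [k0] at this
    linarith
  have hBd : ∀ a b, HasDerivAt (fun t : ℝ => β (a, t)) (deriv A a / k) b := by
    intro a b
    have hd : Differentiable ℝ (fun t : ℝ => β (a, t)) := by fun_prop
    have h1 : HasDerivAt (fun s : ℝ => β (a, s - (-b))) (deriv (fun t : ℝ => β (a, t)) b) 0 := by
      have := (hd (0 - (-b))).hasDerivAt.comp_sub_const 0 (-b)
      simpa using this
    have h2 := (h1.add (hcomp ξ hξ (-b) a)).const_mul (k : ℝ)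
    have h3 : HasDerivAt (fun s : ℝ => s * dslope A a (a + s ^ k)) (deriv A a) 0 := by
      rw [hasDerivAt_iff_tendsto_slope]
      have hc : ContinuousAt (fun s : ℝ => dslope A a (a + s ^ k)) 0 := by
        have e : ContinuousAt (dslope A a) (a + (0 : ℝ) ^ k) := by
          simpa [k0] using continuousAt_dslope_same.2 (hAd a)
        exact ContinuousAt.comp (f := fun s : ℝ => a + s ^ k) e (by fun_prop)
      have h4 := hc.tendsto.mono_left (nhdsWithin_le_nhds (s := {0}ᶜ))
      simp only [ne_eq, k0, not_false_eq_true, zero_pow, add_zero, dslope_same] at h4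
      refine h4.congr' ?_
      filter_upwards [self_mem_nhdsWithin] with s hs
      have hs : s ≠ 0 := hs
      simp [slope_def_field, hs]
    have h5 : (fun s : ℝ => s * dslope A a (a + s ^ k)) =
        fun s : ℝ => (k : ℝ) * (β (a, s - (-b)) + ξ (-b, a + s ^ k)) :=
      funext fun s => (hG (-b) a s).symm
    rw [h5] at h3
    have h6 := h3.unique h2
    have h7 : deriv A a / k = deriv (fun t : ℝ => β (a, t)) b := by
      rw [h6]; field_simp; ring
    rw [h7]
    exact (hd b).hasDerivAt
  have hB : ∀ a b, β (a, b) = deriv A a / k * b + β (a, 0) := by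
    intro a b
    have h1 : ∀ t, HasDerivAt (fun t : ℝ => β (a, t) - deriv A a / k * t) 0 t := by
      intro t
      have := (hBd a t).fun_sub ((hasDerivAt_id t).const_mul (deriv A a / k))
      simpa using this
    have := is_const_of_deriv_eq_zero (fun t => (h1 t).differentiableAt)
      (fun t => (h1 t).deriv) b 0
    simp at this
    linarith
  -- functional equation
  have hE : ∀ a b s, k * s ^ (k - 1) * (β (a, b) - β (a + s ^ k, b - s)) = A (a + s ^ k) - A a := by
    intro a b s
    have := H (s - b) a s
    rw [hαA, hηA, hξβ] at this
    simp only [sub_sub_cancel, neg_sub] at this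
    linarith
  have hD := aux_const k hk (deriv A) (by
    intro a s hs
    have e1 := hE a 1 s
    have e0 := hE a 0 s
    rw [hB a, hB (a + s ^ k)] at e1 e0
    have h4 : s ^ (k - 1) ≠ 0 := pow_ne_zero _ hs
    have : s ^ (k - 1) * (deriv A (a + s ^ k) - deriv A a) = 0 := by
      field_simp at e1 e0
      linarith
    rcases mul_eq_zero.1 this with h | h
    · exact absurd h h4
    · linarith)
  have hAl : ∀ a, A a = deriv A 0 * a + A 0 := by
    intro a
    have h1 : ∀ t, HasDerivAt (fun t : ℝ => A t - deriv A 0 * t) 0 t := by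
      intro t
      have := (hAd t).hasDerivAt.fun_sub ((hasDerivAt_id t).const_mul (deriv A 0))
      rw [hD t] at this
      simpa using this
    have := is_const_of_deriv_eq_zero (fun t => (h1 t).differentiableAt)
      (fun t => (h1 t).deriv) a 0
    simp at this
    linarith
  have hC := aux_const k hk (fun a => β (a, 0)) (by
    intro a s hs
    have e0 := hE a 0 s
    rw [hB (a + s ^ k), hAl (a + s ^ k), hAl a, hD (a + s ^ k)] at e0
    have h4 : s ^ (k - 1) ≠ 0 := pow_ne_zero _ hs
    have h3 : s ^ k = s ^ (k - 1) * s := by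
      rw [← pow_succ]; congr 1; omega
    have : (k * s ^ (k - 1)) * (β (a + s ^ k, 0) - β (a, 0)) = 0 := by
      have e2 : (k : ℝ) * s ^ (k - 1) * (deriv A 0 / k * (0 - s)) = - (deriv A 0 * s ^ k) := by
        rw [h3]; field_simp; ring
      linarith
    rcases mul_eq_zero.1 this with h | h
    · exact absurd h (mul_ne_zero hk0 h4)
    · linarith)
  have hβf : ∀ a b, β (a, b) = deriv A 0 / k * b + β (0, 0) := by
    intro a b; rw [hB, hD, hC]
  have hkc : (k : ℝ) * (deriv A 0 / k) = deriv A 0 := by field_simp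
  refine ⟨deriv A 0 / k, β (0, 0), A 0, ?_, ?_, ?_, hβf⟩
  · intro x y; rw [hξβ, hβf]; ring
  · intro x y; rw [hηA, hkc, hAl]
  · intro x y; rw [hαA, hkc, hAl]

/-- for `k > 2` and `S = {y = a + (x+b)^k}`, the Lie algebra
`𝒜(S)` of infinitesimal multicontact automorphisms (real-analytic
para-holomorphic vector fields tangent to `S`) is exactly the 3-dimensional span
of `V₋ₖ = ∂_a + ∂_y`, `V₋₁ = ∂_b − ∂_x` and
`V₀ = x∂_x + ky∂_y + ka∂_a + b∂_b`. -/
theorem stmt_10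
    (k : ℕ) (hk : 2 < k)
    (P : ℝ → ℝ → ℝ) (hP : P = fun x b => (x + b) ^ k)
    (W : Fin 3 → ((ℝ × ℝ × ℝ × ℝ) → ℝ × ℝ × ℝ × ℝ))
    (hW : W = ![fun _ => ((0 : ℝ), (1 : ℝ), (1 : ℝ), (0 : ℝ)),
      fun _ => ((-1 : ℝ), (0 : ℝ), (0 : ℝ), (1 : ℝ)),
      fun q => (q.1, (k : ℝ) * q.2.1, (k : ℝ) * q.2.2.1, q.2.2.2)]) :
    LinearIndependent ℝ W ∧
    ∀ ξ η α β : ℝ × ℝ → ℝ,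
      AnalyticOnNhd ℝ ξ Set.univ → AnalyticOnNhd ℝ η Set.univ →
      AnalyticOnNhd ℝ α Set.univ → AnalyticOnNhd ℝ β Set.univ →
      (TangentVF P ξ η α β ↔
        ∃ c : Fin 3 → ℝ,
          (fun q : ℝ × ℝ × ℝ × ℝ =>
              ((ξ (q.1, q.2.1), η (q.1, q.2.1),
                α (q.2.2.1, q.2.2.2), β (q.2.2.1, q.2.2.2)) : ℝ × ℝ × ℝ × ℝ))
            = fun q => ∑ i, c i • W i q) := by
  have hk0 : (k : ℝ) ≠ 0 := by positivity
  subst hP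
  have dP1 : ∀ x b : ℝ, deriv (fun t : ℝ => (x + t) ^ k) b = k * (x + b) ^ (k - 1) := by
    intro x b
    simpa using (((hasDerivAt_id b).const_add x).fun_pow k).deriv
  have dP2 : ∀ x b : ℝ, deriv (fun t : ℝ => (t + b) ^ k) x = k * (x + b) ^ (k - 1) := by
    intro x b
    simpa using (((hasDerivAt_id x).add_const b).fun_pow k).deriv
  subst hW
  refine ⟨?_, ?_⟩
  · rw [Fintype.linearIndependent_iff]
    intro g hg
    have h0 := congrFun hg (0, 0, 0, 0)
    have h1 := congrFun hg (1, 0, 0, 0)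
    simp [Fin.sum_univ_three] at h0 h1
    intro i
    fin_cases i
    · simp; tauto
    · simp; tauto
    · simp; obtain ⟨h2, h3, h4⟩ := h1; rw [h4] at h2; linarith
  · intro ξ η α β hξ hη hα hβ
    constructor
    · intro hT
      have dd : ∀ f : ℝ × ℝ → ℝ, AnalyticOnNhd ℝ f Set.univ → Differentiable ℝ f :=
        fun f hf => differentiableOn_univ.1 hf.differentiableOn
      obtain ⟨c, C, d, e1, e2, e3, e4⟩ := aux_main k hk ξ η α β (dd _ hξ) (dd _ hη) (dd _ hα)
        (dd _ hβ) (by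
          intro x a s
          have := hT x a (s - x)
          simp only [dP1, dP2, add_sub_cancel] at this
          linarith)
      refine ⟨![d, C, c], ?_⟩
      funext q
      simp [Fin.sum_univ_three, e1, e2, e3, e4]
      refine ⟨?_, ?_, ?_, ?_⟩ <;> ring
    · rintro ⟨c, hc⟩
      have e : ∀ x y a b : ℝ, ξ (x, y) = -c 1 + c 2 * x ∧ η (x, y) = c 0 + c 2 * (k * y) ∧
          α (a, b) = c 0 + c 2 * (k * a) ∧ β (a, b) = c 1 + c 2 * b := by
        intro x y a b
        have := congrFun hc (x, y, a, b)
        simpa [Fin.sum_univ_three] using this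
      intro x a b
      simp only [dP1, dP2]
      obtain ⟨e1, e2, e3, e4⟩ := e x (a + (x + b) ^ k) a b
      rw [e1, e2, e3, e4]
      have h3 : (x + b) ^ k = (x + b) ^ (k - 1) * (x + b) := by
        rw [← pow_succ]; congr 1; omega
      rw [h3]
      ring
end

section
/- Let k > 2 be an integer and γ₁,…,γ_{k−1} real numbers such that at least two of the γᵢ are nonzero and such that there exist no real numbers δ, ν with γᵢ = C(k,i)·δ·νᶦ for all 1 ≤ i ≤ k−1 (C(k,i) the binomial coefficient). Let P(x,b) = ∑_{i=1}^{k−1} γᵢ bⁱ x^{k−i} and S = {y = a + P(x,b)} ⊂ ℝ⁴. Then the real Lie algebra 𝒜(S) of infinitesimal multicontact automorphisms of S is exactly the 2-dimensional linear span of V_{−k} = ∂_a + ∂_y and V₀ = x∂_x + ky∂_y + ka∂_a + b∂_b, and it satisfies [V₀, V_{−k}] = −k·V_{−k}. -/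
/-- The polynomial `P(x,b) = ∑_{i=1}^{k-1} γᵢ bⁱ x^{k-i}`. -/
def Ppoly (k : ℕ) (γ : ℕ → ℝ) (x b : ℝ) : ℝ :=
  ∑ i ∈ Finset.Icc 1 (k - 1), γ i * b ^ i * x ^ (k - i)

noncomputable def PbS (k : ℕ) (γ : ℕ → ℝ) (x b : ℝ) : ℝ :=
  ∑ i ∈ Finset.Icc 1 (k - 1), γ i * ((i : ℝ) * b ^ (i - 1)) * x ^ (k - i)

noncomputable def PxS (k : ℕ) (γ : ℕ → ℝ) (x b : ℝ) : ℝ :=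
  ∑ i ∈ Finset.Icc 1 (k - 1), γ i * b ^ i * (((k - i : ℕ) : ℝ) * x ^ (k - i - 1))

lemma deriv_Pb (k : ℕ) (γ : ℕ → ℝ) (x b : ℝ) :
    deriv (fun t => Ppoly k γ x t) b = PbS k γ x b := by
  apply HasDerivAt.deriv
  unfold Ppoly PbS
  apply HasDerivAt.fun_sum
  intro i _
  exact ((hasDerivAt_pow i b).const_mul (γ i)).mul_const _

lemma deriv_Px (k : ℕ) (γ : ℕ → ℝ) (x b : ℝ) :
    deriv (fun t => Ppoly k γ t b) x = PxS k γ x b := by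
  apply HasDerivAt.deriv
  unfold Ppoly PxS
  apply HasDerivAt.fun_sum
  intro i _
  exact ((hasDerivAt_pow (k - i) x).const_mul (γ i * b ^ i))

lemma euler_P (k : ℕ) (γ : ℕ → ℝ) (x b : ℝ) :
    x * PxS k γ x b + b * PbS k γ x b = k * Ppoly k γ x b := by
  unfold Ppoly PbS PxS
  rw [Finset.mul_sum, Finset.mul_sum, Finset.mul_sum, ← Finset.sum_add_distrib]
  apply Finset.sum_congr rfl
  intro i hi
  rw [Finset.mem_Icc] at hi
  obtain ⟨m, hm⟩ : ∃ m, k = i + (m + 1) := ⟨k - i - 1, by omega⟩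
  obtain ⟨j, rfl⟩ : ∃ j, i = j + 1 := ⟨i - 1, by omega⟩
  subst hm
  simp only [Nat.add_sub_cancel_left, Nat.add_sub_cancel]
  push_cast
  ring

noncomputable def sw (k : ℕ) (γ : ℕ → ℝ) : ℕ → ℝ := fun i => - γ (k - i)

lemma sw_P (k : ℕ) (γ : ℕ → ℝ) (x b : ℝ) :
    Ppoly k (sw k γ) b x = - Ppoly k γ x b := by
  unfold Ppoly sw
  rw [← Finset.sum_neg_distrib]
  apply Finset.sum_nbij' (fun i => k - i) (fun i => k - i)
  all_goals intro i hi; simp only [Finset.mem_Icc] at hi ⊢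
  · omega
  · omega
  · omega
  · omega
  · rw [show k - (k - i) = i by omega]; ring

lemma sw_Pb (k : ℕ) (γ : ℕ → ℝ) (x b : ℝ) :
    PbS k (sw k γ) b x = - PxS k γ x b := by
  unfold PbS PxS sw
  rw [← Finset.sum_neg_distrib]
  apply Finset.sum_nbij' (fun i => k - i) (fun i => k - i)
  all_goals intro i hi; simp only [Finset.mem_Icc] at hi ⊢
  · omega
  · omega
  · omega
  · omega
  · rw [show k - (k - i) = i by omega]; ring

lemma sw_Px (k : ℕ) (γ : ℕ → ℝ) (x b : ℝ) :
    PxS k (sw k γ) b x = - PbS k γ x b := by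
  unfold PbS PxS sw
  rw [← Finset.sum_neg_distrib]
  apply Finset.sum_nbij' (fun i => k - i) (fun i => k - i)
  all_goals intro i hi; simp only [Finset.mem_Icc] at hi ⊢
  · omega
  · omega
  · omega
  · omega
  · rw [show k - (k - i) = i by omega]; ring

lemma zero_of_punctured (F : ℝ → ℝ) (hF : ContinuousAt F 0) (h : ∀ t, t ≠ 0 → F t = 0) :
    F 0 = 0 := by
  have h1 : Filter.Tendsto F (nhdsWithin 0 {0}ᶜ) (nhds (F 0)) := hF.tendsto.mono_left nhdsWithin_le_nhds
  have h2 : Filter.Tendsto F (nhdsWithin 0 {0}ᶜ) (nhds 0) := by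
    apply tendsto_const_nhds.congr'
    filter_upwards [self_mem_nhdsWithin] with t ht
    exact (h t ht).symm
  exact tendsto_nhds_unique h1 h2

lemma sub_eq_dslope (f : ℝ → ℝ) (a y : ℝ) : f y = f a + (y - a) * dslope f a y := by
  have := sub_smul_dslope f a y
  rw [smul_eq_mul] at this
  linarith

/-- factor out the lowest power of `b` -/
lemma factor_low (k : ℕ) (γ : ℕ → ℝ) (m : ℕ) (hm : m ∈ Finset.Icc 1 (k - 1))
    (hlow : ∀ i ∈ Finset.Icc 1 (k - 1), i < m → γ i = 0) (x : ℝ) :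
    ∃ A B C : ℝ → ℝ, Continuous A ∧ Continuous B ∧ Continuous C ∧
      (∀ b, Ppoly k γ x b = b ^ m * A b) ∧ (∀ b, PxS k γ x b = b ^ m * B b) ∧
      (∀ b, b * PbS k γ x b = b ^ m * C b) ∧
      A 0 = γ m * x ^ (k - m) ∧ B 0 = γ m * (((k - m : ℕ) : ℝ) * x ^ (k - m - 1)) ∧
      C 0 = γ m * m * x ^ (k - m) := by
  have key : ∀ c : ℕ → ℝ, ∑ i ∈ Finset.Icc 1 (k - 1), γ i * c i * (0:ℝ) ^ (i - m) = γ m * c m := by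
    intro c
    rw [Finset.sum_eq_single_of_mem m hm]
    · simp
    · intro i hi hne
      rcases lt_or_gt_of_ne hne with h | h
      · simp [hlow i hi h]
      · rw [zero_pow (by omega)]; simp
  have key2 : ∀ (c : ℕ → ℝ) (b : ℝ), ∑ i ∈ Finset.Icc 1 (k - 1), γ i * c i * b ^ i
      = b ^ m * ∑ i ∈ Finset.Icc 1 (k - 1), γ i * c i * b ^ (i - m) := by
    intro c b
    rw [Finset.mul_sum]
    apply Finset.sum_congr rfl
    intro i hi
    rcases lt_or_ge i m with h | h
    · simp [hlow i hi h]
    · rw [← pow_sub_mul_pow b h]; ring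
  refine ⟨fun b => ∑ i ∈ Finset.Icc 1 (k - 1), γ i * x ^ (k - i) * b ^ (i - m),
    fun b => ∑ i ∈ Finset.Icc 1 (k - 1), γ i * (((k - i : ℕ) : ℝ) * x ^ (k - i - 1)) * b ^ (i - m),
    fun b => ∑ i ∈ Finset.Icc 1 (k - 1), γ i * (i * x ^ (k - i)) * b ^ (i - m),
    by fun_prop, by fun_prop, by fun_prop, ?_, ?_, ?_, ?_, ?_, ?_⟩
  · intro b
    rw [← key2 (fun i => x ^ (k - i))]
    exact Finset.sum_congr rfl fun i _ => by ring
  · intro b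
    rw [← key2 (fun i => ((k - i : ℕ) : ℝ) * x ^ (k - i - 1))]
    exact Finset.sum_congr rfl fun i _ => by ring
  · intro b
    rw [← key2 (fun i => i * x ^ (k - i))]
    unfold PbS
    rw [Finset.mul_sum]
    refine Finset.sum_congr rfl fun i hi => ?_
    rw [Finset.mem_Icc] at hi
    obtain ⟨j, rfl⟩ : ∃ j, i = j + 1 := ⟨i - 1, by omega⟩
    simp only [Nat.add_sub_cancel]
    ring
  · exact key (fun i => x ^ (k - i))
  · exact key (fun i => ((k - i : ℕ) : ℝ) * x ^ (k - i - 1))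
  · rw [mul_assoc]; exact key (fun i => i * x ^ (k - i))

lemma step2 (k : ℕ) (γ : ℕ → ℝ) (m : ℕ) (hm : m ∈ Finset.Icc 1 (k - 1)) (hγ : γ m ≠ 0)
    (hlow : ∀ i ∈ Finset.Icc 1 (k - 1), i < m → γ i = 0)
    (f : ℝ → ℝ) (ξ β : ℝ → ℝ → ℝ) (hf : Differentiable ℝ f)
    (hβ : ∀ a, Differentiable ℝ (β a)) (hξ : ∀ x, Continuous (ξ x))
    (hβ0 : ∀ a, β a 0 = 0) (hξ0 : ∀ y, ξ 0 y = 0)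
    (heq : ∀ x a b, f a + β a b * PbS k γ x b + ξ x (a + Ppoly k γ x b) * PxS k γ x b
      = f (a + Ppoly k γ x b)) (x a : ℝ) :
    deriv (β a) 0 * m * x + ξ x a * ((k : ℝ) - m) = deriv f a * x := by
  by_cases hx : x = 0
  · subst hx; simp [hξ0]
  obtain ⟨A, B, C, hA, hB, hC, eA, eB, eC, A0, B0, C0⟩ := factor_low k γ m hm hlow x
  have hm' := Finset.mem_Icc.1 hm
  set F : ℝ → ℝ := fun b => dslope (β a) 0 b * C b + ξ x (a + b ^ m * A b) * B b
    - dslope f a (a + b ^ m * A b) * A b with hF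
  have hu : ContinuousAt (fun b => a + b ^ m * A b) 0 := by fun_prop
  have hu0 : (fun b => a + b ^ m * A b) 0 = a := by
    simp [zero_pow (show m ≠ 0 by omega)]
  have hd1 : ContinuousAt (dslope f a) ((fun b => a + b ^ m * A b) 0) := by
    rw [hu0]; exact continuousAt_dslope_same.2 (hf a)
  have hd2 : ContinuousAt (dslope (β a) 0) 0 := continuousAt_dslope_same.2 (hβ a 0)
  have hcF : ContinuousAt F 0 := by
    refine ((hd2.mul hC.continuousAt).add (ContinuousAt.mul ?_ hB.continuousAt)).sub
      (ContinuousAt.mul ?_ hA.continuousAt)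
    · exact ((hξ x).continuousAt).comp hu
    · exact ContinuousAt.comp (g := dslope f a) (f := fun b => a + b ^ m * A b) hd1 hu
  have h0 := zero_of_punctured F hcF (by
    intro b hb
    have h1 := heq x a b
    have h2 := sub_eq_dslope (β a) 0 b
    have h3 := sub_eq_dslope f a (a + Ppoly k γ x b)
    rw [hβ0, sub_zero, zero_add] at h2
    rw [h3, h2] at h1
    have h4 := eC b
    rw [eA, eB] at h1
    have hbm : b ^ m ≠ 0 := pow_ne_zero _ hb
    apply mul_left_cancel₀ hbm
    simp only [hF]
    linear_combination h1 - dslope (β a) 0 b * h4)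
  simp only [hF] at h0
  simp only at hu0
  rw [hu0, dslope_same, dslope_same, A0, B0, C0, Nat.cast_sub (by omega)] at h0
  have hxp : γ m * x ^ (k - m - 1) ≠ 0 := mul_ne_zero hγ (pow_ne_zero _ hx)
  have hp : x ^ (k - m) = x ^ (k - m - 1) * x := by
    rw [← pow_succ]; congr 1; omega
  rw [hp] at h0
  apply mul_left_cancel₀ hxp
  linear_combination h0

lemma deriv_dslope_same (f : ℝ → ℝ) (a : ℝ) (hf : AnalyticAt ℝ f a) :
    DifferentiableAt ℝ (dslope f a) a ∧ deriv (deriv f) a = 2 * deriv (dslope f a) a := by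
  obtain ⟨p, hp⟩ := hf
  have hq := hp.has_fpower_series_dslope_fslope
  have hq' : AnalyticAt ℝ (dslope f a) a := ⟨_, hq⟩
  refine ⟨hq'.differentiableAt, ?_⟩
  have h1 : deriv f =ᶠ[nhds a] fun y => dslope f a y + (y - a) * deriv (dslope f a) y := by
    filter_upwards [hq'.eventually_analyticAt] with y hy
    have : f = fun y => f a + (y - a) * dslope f a y := by
      ext y; exact sub_eq_dslope f a y
    have h2 : HasDerivAt (fun y => f a + (y - a) * dslope f a y)
        (1 * dslope f a y + (y - a) * deriv (dslope f a) y) y :=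
      (((hasDerivAt_id y).sub_const a).mul hy.differentiableAt.hasDerivAt).const_add (f a)
    rw [← this] at h2
    rw [h2.deriv]; ring
  rw [h1.deriv_eq]
  have h3 := hq'.differentiableAt.hasDerivAt.add
    (((hasDerivAt_id a).sub_const a).mul hq'.deriv.differentiableAt.hasDerivAt)
  have h4 := h3.deriv
  simp only [id, sub_self, zero_mul, add_zero, one_mul] at h4
  calc _ = _ := h4
    _ = _ := by ring

lemma step3 (k : ℕ) (hk : 0 < k) (γ : ℕ → ℝ) (m : ℕ) (hm : m ∈ Finset.Icc 1 (k - 1)) (hγ : γ m ≠ 0)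
    (hlow : ∀ i ∈ Finset.Icc 1 (k - 1), i < m → γ i = 0)
    (f : ℝ → ℝ) (hf : ∀ a, AnalyticAt ℝ f a)
    (heq : ∀ x a b, f a + b * deriv f a / k * PbS k γ x b
      + x * deriv f (a + Ppoly k γ x b) / k * PxS k γ x b
      = f (a + Ppoly k γ x b)) (a : ℝ) :
    deriv (deriv f) a * ((k : ℝ) - 2 * m) = 0 := by
  obtain ⟨A, B, C, hA, hB, hC, eA, eB, eC, A0, B0, C0⟩ := factor_low k γ m hm hlow 1
  have hm' := Finset.mem_Icc.1 hm
  obtain ⟨hdd, h2d⟩ := deriv_dslope_same f a (hf a)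
  have hk0 : (k : ℝ) ≠ 0 := by positivity
  set D := dslope (dslope f a) a with hD
  set E := dslope (deriv f) a with hE
  have hDc : ContinuousAt D a := continuousAt_dslope_same.2 hdd
  have hEc : ContinuousAt E a := continuousAt_dslope_same.2 (hf a).deriv.differentiableAt
  set u : ℝ → ℝ := fun b => a + b ^ m * A b with hu'
  have hu : ContinuousAt u 0 := by fun_prop
  have hu0 : u 0 = a := by
    simp [hu', zero_pow (show m ≠ 0 by omega)]
  set F : ℝ → ℝ := fun b => k * (D (u b) * A b ^ 2) - E (u b) * A b * B b with hF
  have hDu : ContinuousAt (fun b => D (u b)) 0 :=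
    ContinuousAt.comp (g := D) (f := u) (by rw [hu0]; exact hDc) hu
  have hEu : ContinuousAt (fun b => E (u b)) 0 :=
    ContinuousAt.comp (g := E) (f := u) (by rw [hu0]; exact hEc) hu
  have hcF : ContinuousAt F 0 := by
    have := hA.continuousAt (x := 0)
    have := hB.continuousAt (x := 0)
    exact (continuousAt_const.mul (hDu.mul (this.pow 2 |> fun _ => hA.continuousAt.pow 2))).sub
      ((hEu.mul hA.continuousAt).mul hB.continuousAt)
  have h0 := zero_of_punctured F hcF (by
    intro b hb
    have h1 := heq 1 a b
    have h2 := sub_eq_dslope (deriv f) a (u b)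
    have h3 := sub_eq_dslope f a (u b)
    have h3' := sub_eq_dslope (dslope f a) a (u b)
    rw [dslope_same] at h3'
    rw [h3'] at h3
    have h4 := euler_P k γ 1 b
    rw [eA, eB] at h4 h1
    have hub : u b - a = b ^ m * A b := by simp [hu']
    change _ + _ * deriv f (u b) / _ * _ = f (u b) at h1
    rw [hub] at h2 h3
    rw [h2, h3] at h1
    have hbm : (b ^ m) ^ 2 ≠ 0 := pow_ne_zero _ (pow_ne_zero _ hb)
    apply mul_left_cancel₀ hbm
    simp only [hF]
    field_simp at h1
    linear_combination -h1 + deriv f a * h4)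
  simp only [hF] at h0
  rw [hu0, hD, hE, dslope_same, dslope_same, A0, B0, h2d, Nat.cast_sub (by omega)] at h0
  simp only [one_pow, mul_one] at h0
  rw [h2d]
  have : γ m ^ 2 ≠ 0 := pow_ne_zero _ hγ
  apply mul_left_cancel₀ this
  linear_combination -2 * h0

lemma step1_lim (k : ℕ) (hk : 2 < k) (γ : ℕ → ℝ) (ξ η α β : ℝ × ℝ → ℝ)
    (hξ : Continuous ξ) (hα : Differentiable ℝ (fun a => α (a, 0))) (hβ : Continuous β)
    (hα' : ∀ a b, α (a, b) = α (a, 0) - γ (k - 1) * ξ (0, a) * b ^ (k - 1))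
    (hη' : ∀ x y, η (x, y) = α (y, 0) + γ 1 * β (y, 0) * x ^ (k - 1))
    (heq : ∀ x a b, α (a, b) + β (a, b) * PbS k γ x b + ξ (x, a + Ppoly k γ x b) * PxS k γ x b
      - η (x, a + Ppoly k γ x b) = 0) (a b : ℝ) :
    β (a, 0) * PbS k γ 1 b + ξ (0, a) * PxS k γ 1 b - γ (k - 1) * ξ (0, a) * b ^ (k - 1)
      - γ 1 * β (a, 0) = 0 := by
  have homP : ∀ t, Ppoly k γ t (t * b) = t ^ k * Ppoly k γ 1 b := by
    intro t
    unfold Ppoly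
    rw [Finset.mul_sum]
    refine Finset.sum_congr rfl fun i hi => ?_
    rw [Finset.mem_Icc] at hi
    rw [mul_pow, one_pow, show t ^ k = t ^ i * t ^ (k - i) by rw [← pow_add]; congr 1; omega]
    ring
  have homb : ∀ t, PbS k γ t (t * b) = t ^ (k - 1) * PbS k γ 1 b := by
    intro t
    unfold PbS
    rw [Finset.mul_sum]
    refine Finset.sum_congr rfl fun i hi => ?_
    rw [Finset.mem_Icc] at hi
    rw [mul_pow, one_pow, show t ^ (k - 1) = t ^ (i - 1) * t ^ (k - i) by
      rw [← pow_add]; congr 1; omega]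
    ring
  have homx : ∀ t, PxS k γ t (t * b) = t ^ (k - 1) * PxS k γ 1 b := by
    intro t
    unfold PxS
    rw [Finset.mul_sum]
    refine Finset.sum_congr rfl fun i hi => ?_
    rw [Finset.mem_Icc] at hi
    rw [mul_pow, one_pow, show t ^ (k - 1) = t ^ i * t ^ (k - i - 1) by
      rw [← pow_add]; congr 1; omega]
    ring
  set f : ℝ → ℝ := fun a => α (a, 0) with hf
  set p := Ppoly k γ 1 b
  set u : ℝ → ℝ := fun t => a + t ^ k * p with hu'
  have hu : Continuous u := by fun_prop
  have hu0 : u 0 = a := by simp [hu', zero_pow (show k ≠ 0 by omega)]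
  set F : ℝ → ℝ := fun t => β (a, t * b) * PbS k γ 1 b + ξ (t, u t) * PxS k γ 1 b
    - γ (k - 1) * ξ (0, a) * b ^ (k - 1) - γ 1 * β (u t, 0) - t * p * dslope f a (u t) with hF
  have hd : ContinuousAt (fun t => dslope f a (u t)) 0 :=
    ContinuousAt.comp (g := dslope f a) (f := u)
      (by rw [hu0]; exact continuousAt_dslope_same.2 (hα a)) hu.continuousAt
  have hcF : ContinuousAt F 0 := by
    have h1 : Continuous (fun t => β (a, t * b) * PbS k γ 1 b + ξ (t, u t) * PxS k γ 1 b
      - γ (k - 1) * ξ (0, a) * b ^ (k - 1) - γ 1 * β (u t, 0)) := by fun_prop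
    have h2 : Continuous (fun t : ℝ => t * p) := by fun_prop
    exact h1.continuousAt.sub (h2.continuousAt.mul hd)
  have h0 := zero_of_punctured F hcF (by
    intro t ht
    have h1 := heq t a (t * b)
    rw [homP, homb, homx, hα', hη'] at h1
    have h2 := sub_eq_dslope f a (u t)
    have hub : u t - a = t ^ k * p := by simp [hu']
    rw [hub] at h2
    have hbm : t ^ (k - 1) ≠ 0 := pow_ne_zero _ ht
    have hk1 : t ^ k = t ^ (k - 1) * t := by rw [← pow_succ]; congr 1; omega
    apply mul_left_cancel₀ hbm
    simp only [hF]
    change f a - _ + _ + ξ (t, u t) * _ - (f (u t) + _ * β (u t, 0) * _) = 0 at h1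
    rw [h2, mul_pow] at h1
    linear_combination h1 + p * dslope f a (u t) * hk1)
  simp only [hF, hu0] at h0
  rw [zero_mul] at h0
  linear_combination h0

lemma step1_coeff (k : ℕ) (hk : 2 < k) (γ : ℕ → ℝ) (p q : ℝ)
    (h : ∀ b, q * PbS k γ 1 b + p * PxS k γ 1 b - γ (k - 1) * p * b ^ (k - 1)
      - γ 1 * q = 0) (j : ℕ) (hj1 : 1 ≤ j) (hj2 : j + 2 ≤ k) :
    q * ((j + 1 : ℕ) : ℝ) * γ (j + 1) + p * ((k : ℝ) - j) * γ j = 0 := by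
  open Polynomial in
  set Q : ℝ[X] := ∑ i ∈ Finset.Icc 1 (k - 1), C (q * γ i * i) * X ^ (i - 1)
    + ∑ i ∈ Finset.Icc 1 (k - 1), C (p * γ i * ((k - i : ℕ) : ℝ)) * X ^ i
    - C (γ (k - 1) * p) * X ^ (k - 1) - C (γ 1 * q) * X ^ 0 with hQ
  have hQ0 : Q = 0 := by
    apply Polynomial.funext
    intro b
    rw [Polynomial.eval_zero, ← h b]
    simp only [hQ, Polynomial.eval_sub, Polynomial.eval_add, Polynomial.eval_finsetSum,
      Polynomial.eval_mul, Polynomial.eval_C, Polynomial.eval_pow, Polynomial.eval_X,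
      PbS, PxS, Finset.mul_sum, one_pow, pow_zero, mul_one]
    congr 3
    · exact Finset.sum_congr rfl fun i _ => by ring
    · exact Finset.sum_congr rfl fun i _ => by ring
  have hc : Q.coeff j = 0 := by rw [hQ0]; simp
  simp only [hQ, Polynomial.coeff_sub, Polynomial.coeff_add, Polynomial.finsetSum_coeff,
    Polynomial.coeff_C_mul_X_pow] at hc
  rw [if_neg (by omega), if_neg (by omega), Finset.sum_ite_eq, if_pos (Finset.mem_Icc.2 (by omega)),
    Finset.sum_eq_single_of_mem (j + 1) (Finset.mem_Icc.2 (by omega)), if_pos (by omega),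
    Nat.cast_sub (by omega)] at hc
  · linear_combination hc
  · intro i hi hne
    rw [Finset.mem_Icc] at hi
    rw [if_neg (by omega)]

lemma step1_alg (k : ℕ) (hk : 2 < k) (γ : ℕ → ℝ)
    (h2 : ∃ i ∈ Finset.Icc 1 (k - 1), ∃ j ∈ Finset.Icc 1 (k - 1),
      i ≠ j ∧ γ i ≠ 0 ∧ γ j ≠ 0)
    (hnotbin : ¬ ∃ δ ν : ℝ, ∀ i ∈ Finset.Icc 1 (k - 1),
      γ i = (k.choose i : ℝ) * δ * ν ^ i) (p q : ℝ)
    (h : ∀ j : ℕ, 1 ≤ j → j + 2 ≤ k →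
      q * ((j + 1 : ℕ) : ℝ) * γ (j + 1) + p * ((k : ℝ) - j) * γ j = 0) : p = 0 ∧ q = 0 := by
  obtain ⟨i, hi, j, hj, hij, hγi, hγj⟩ := h2
  rw [Finset.mem_Icc] at hi hj
  by_cases hp : p = 0
  · refine ⟨hp, ?_⟩
    by_contra hq
    have hz : ∀ l, 2 ≤ l → l ≤ k - 1 → γ l = 0 := by
      intro l h1 h2
      obtain ⟨n, rfl⟩ : ∃ n, l = n + 1 := ⟨l - 1, by omega⟩
      have := h n (by omega) (by omega)
      rw [hp] at this
      have hn : ((n + 1 : ℕ) : ℝ) ≠ 0 := by positivity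
      simpa [hq, hn, Nat.cast_add_one_ne_zero] using this
    rcases lt_or_ge i 2 with h1 | h1
    · exact hγj (hz j (by omega) (by omega))
    · exact hγi (hz i h1 (by omega))
  exfalso
  by_cases hq : q = 0
  · have hz : ∀ l, 1 ≤ l → l + 2 ≤ k → γ l = 0 := by
      intro l h1 h2
      have := h l h1 h2
      have hn : (k : ℝ) - l ≠ 0 := by
        have : (l : ℝ) + 2 ≤ k := by exact_mod_cast h2
        linarith
      simpa [hp, hq, hn] using this
    rcases lt_or_ge (i + 1) k with h1 | h1
    · rcases lt_or_ge (i + 2) (k + 1) with h3 | h3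
      · exact hγi (hz i (by omega) (by omega))
      · exact hγj (hz j (by omega) (by omega))
    · exact hγj (hz j (by omega) (by omega))
  apply hnotbin
  have hk0 : (k : ℝ) ≠ 0 := by positivity
  refine ⟨γ 1 / (k * (-p / q)), -p / q, ?_⟩
  intro l hl
  rw [Finset.mem_Icc] at hl
  obtain ⟨l1, l2⟩ := hl
  induction l, l1 using Nat.le_induction with
  | base => rw [Nat.choose_one_right]; field_simp
  | succ n hn ih =>
    have e1 := ih (by omega)
    have e2 := h n hn (by omega)
    have e3 : ((k.choose (n + 1) : ℕ) : ℝ) * ((n + 1 : ℕ) : ℝ) = k.choose n * ((k : ℝ) - n) := by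
      rw [← Nat.cast_sub (by omega)]
      exact_mod_cast Nat.choose_succ_right_eq k n
    have hn1 : q * ((n + 1 : ℕ) : ℝ) ≠ 0 := mul_ne_zero hq (by positivity)
    apply mul_left_cancel₀ hn1
    have e4 : q * (-p / q) = -p := by field_simp
    generalize -p / q = ν at *
    generalize γ 1 / (k * ν) = δ at *
    rw [pow_succ]
    linear_combination e2 - p * (k - n) * e1 - δ * ν ^ n * ν * q * e3
      - (k.choose n * (k - n) * δ * ν ^ n) * e4

lemma P_x0 (k : ℕ) (hk : 2 < k) (γ : ℕ → ℝ) (b : ℝ) :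
    Ppoly k γ 0 b = 0 ∧ PbS k γ 0 b = 0 ∧ PxS k γ 0 b = γ (k - 1) * b ^ (k - 1) := by
  refine ⟨?_, ?_, ?_⟩
  · refine Finset.sum_eq_zero fun i hi => ?_
    rw [Finset.mem_Icc] at hi
    rw [zero_pow (by omega), mul_zero]
  · refine Finset.sum_eq_zero fun i hi => ?_
    rw [Finset.mem_Icc] at hi
    rw [zero_pow (by omega), mul_zero]
  · unfold PxS
    rw [Finset.sum_eq_single_of_mem (k - 1) (Finset.mem_Icc.2 (by omega))]
    · rw [show k - (k - 1) = 1 by omega]; simp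
    · intro i hi hne
      rw [Finset.mem_Icc] at hi
      rw [zero_pow (by omega), mul_zero, mul_zero]

lemma P_b0 (k : ℕ) (hk : 2 < k) (γ : ℕ → ℝ) (x : ℝ) :
    Ppoly k γ x 0 = 0 ∧ PxS k γ x 0 = 0 ∧ PbS k γ x 0 = γ 1 * x ^ (k - 1) := by
  refine ⟨?_, ?_, ?_⟩
  · refine Finset.sum_eq_zero fun i hi => ?_
    rw [Finset.mem_Icc] at hi
    rw [zero_pow (by omega), mul_zero, zero_mul]
  · refine Finset.sum_eq_zero fun i hi => ?_
    rw [Finset.mem_Icc] at hi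
    rw [zero_pow (by omega), mul_zero, zero_mul]
  · unfold PbS
    rw [Finset.sum_eq_single_of_mem 1 (Finset.mem_Icc.2 (by omega))]
    · simp
    · intro i hi hne
      rw [Finset.mem_Icc] at hi
      rw [zero_pow (by omega), mul_zero, mul_zero, zero_mul]

lemma extremes (k : ℕ) (γ : ℕ → ℝ)
    (h2 : ∃ i ∈ Finset.Icc 1 (k - 1), ∃ j ∈ Finset.Icc 1 (k - 1),
      i ≠ j ∧ γ i ≠ 0 ∧ γ j ≠ 0) :
    ∃ m ∈ Finset.Icc 1 (k - 1), ∃ n ∈ Finset.Icc 1 (k - 1), m < n ∧ γ m ≠ 0 ∧ γ n ≠ 0 ∧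
      (∀ i ∈ Finset.Icc 1 (k - 1), i < m → γ i = 0) ∧
      (∀ i ∈ Finset.Icc 1 (k - 1), n < i → γ i = 0) := by
  classical
  obtain ⟨i, hi, j, hj, hij, hγi, hγj⟩ := h2
  set T := (Finset.Icc 1 (k - 1)).filter (fun i => γ i ≠ 0) with hT
  have hiT : i ∈ T := Finset.mem_filter.2 ⟨hi, hγi⟩
  have hjT : j ∈ T := Finset.mem_filter.2 ⟨hj, hγj⟩
  have hne : T.Nonempty := ⟨i, hiT⟩
  have h1 := Finset.mem_filter.1 (T.min'_mem hne)
  have h3 := Finset.mem_filter.1 (T.max'_mem hne)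
  refine ⟨T.min' hne, h1.1, T.max' hne, h3.1, ?_, h1.2, h3.2, ?_, ?_⟩
  · have := T.min'_le i hiT
    have := T.min'_le j hjT
    have := T.le_max' i hiT
    have := T.le_max' j hjT
    omega
  · intro l hl hlt
    by_contra h
    have := T.min'_le l (Finset.mem_filter.2 ⟨hl, h⟩)
    omega
  · intro l hl hlt
    by_contra h
    have := T.le_max' l (Finset.mem_filter.2 ⟨hl, h⟩)
    omega

lemma forward (k : ℕ) (hk : 2 < k) (γ : ℕ → ℝ)
    (h2 : ∃ i ∈ Finset.Icc 1 (k - 1), ∃ j ∈ Finset.Icc 1 (k - 1),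
      i ≠ j ∧ γ i ≠ 0 ∧ γ j ≠ 0)
    (hnotbin : ¬ ∃ δ ν : ℝ, ∀ i ∈ Finset.Icc 1 (k - 1),
      γ i = (k.choose i : ℝ) * δ * ν ^ i)
    (ξ η α β : ℝ × ℝ → ℝ) (hξ : AnalyticOnNhd ℝ ξ Set.univ)
    (hα : AnalyticOnNhd ℝ α Set.univ) (hβ : AnalyticOnNhd ℝ β Set.univ)
    (hT : TangentVF (Ppoly k γ) ξ η α β) :
    ∃ c d : ℝ, ∀ s t, ξ (s, t) = c * s ∧ η (s, t) = d + c * (k * t) ∧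
      α (s, t) = d + c * (k * s) ∧ β (s, t) = c * t := by
  have heq : ∀ x a b, α (a, b) + β (a, b) * PbS k γ x b
      + ξ (x, a + Ppoly k γ x b) * PxS k γ x b - η (x, a + Ppoly k γ x b) = 0 := by
    intro x a b
    have := hT x a b
    rwa [deriv_Pb, deriv_Px] at this
  have hk0 : (k : ℝ) ≠ 0 := by positivity
  have hx0 : ∀ a b, α (a, b) + ξ (0, a) * (γ (k - 1) * b ^ (k - 1)) - η (0, a) = 0 := by
    intro a b
    have := heq 0 a b
    obtain ⟨e1, e2, e3⟩ := P_x0 k hk γ b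
    rw [e1, e2, e3, mul_zero, add_zero, add_zero] at this
    exact this
  have hb0 : ∀ x a, α (a, 0) + β (a, 0) * (γ 1 * x ^ (k - 1)) - η (x, a) = 0 := by
    intro x a
    have := heq x a 0
    obtain ⟨e1, e2, e3⟩ := P_b0 k hk γ x
    rw [e1, e2, e3, mul_zero, add_zero, add_zero] at this
    exact this
  have hz : ∀ a, α (a, 0) = η (0, a) := by
    intro a
    have := hx0 a 0
    rw [zero_pow (by omega), mul_zero, mul_zero] at this
    linarith
  have hα' : ∀ a b, α (a, b) = α (a, 0) - γ (k - 1) * ξ (0, a) * b ^ (k - 1) := by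
    intro a b
    linear_combination hx0 a b - hz a
  have hη' : ∀ x y, η (x, y) = α (y, 0) + γ 1 * β (y, 0) * x ^ (k - 1) := by
    intro x y
    linear_combination -hb0 x y
  set f : ℝ → ℝ := fun a => α (a, 0) with hf
  have hfa : ∀ a, AnalyticAt ℝ f a := fun a => (hα (a, 0) trivial).curry_left
  have hfd : Differentiable ℝ f := fun a => (hfa a).differentiableAt
  have hξc : Continuous ξ := continuousOn_univ.1 hξ.continuousOn
  have hβc : Continuous β := continuousOn_univ.1 hβ.continuousOn
  have hpq : ∀ a, ξ (0, a) = 0 ∧ β (a, 0) = 0 := by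
    intro a
    apply step1_alg k hk γ h2 hnotbin
    exact step1_coeff k hk γ _ _ (step1_lim k hk γ ξ η α β hξc hfd hβc hα' hη' heq a)
  have hαf : ∀ a b, α (a, b) = f a := by
    intro a b; rw [hα', (hpq a).1]; simp [hf]
  have hηf : ∀ x y, η (x, y) = f y := by
    intro a b; rw [hη', (hpq b).2]; simp [hf]
  have heq2 : ∀ x a b, f a + β (a, b) * PbS k γ x b + ξ (x, a + Ppoly k γ x b) * PxS k γ x b
      = f (a + Ppoly k γ x b) := by
    intro x a b
    have := heq x a b
    rw [hαf, hηf] at this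
    linarith
  obtain ⟨m, hm, n, hn, hmn, hγm, hγn, hlo, hhi⟩ := extremes k γ h2
  have hm' := Finset.mem_Icc.1 hm
  have hn' := Finset.mem_Icc.1 hn
  have hnk : k - n ∈ Finset.Icc 1 (k - 1) := Finset.mem_Icc.2 (by omega)
  have hswn : sw k γ (k - n) ≠ 0 := by
    unfold sw; rw [show k - (k - n) = n by omega]; exact neg_ne_zero.2 hγn
  have hswlo : ∀ i ∈ Finset.Icc 1 (k - 1), i < k - n → sw k γ i = 0 := by
    intro i hi hlt
    rw [Finset.mem_Icc] at hi
    unfold sw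
    rw [hhi (k - i) (Finset.mem_Icc.2 (by omega)) (by omega), neg_zero]
  have r1 := step2 k γ m hm hγm hlo f (fun x y => ξ (x, y)) (fun a b => β (a, b)) hfd
    (fun a b => ((hβ (a, b) trivial).curry_right).differentiableAt) (fun x => by fun_prop)
    (fun a => (hpq a).2) (fun a => (hpq a).1) heq2
  have r2 := step2 k (sw k γ) (k - n) hnk hswn hswlo f (fun b y => β (y, b)) (fun y x => ξ (x, y))
    hfd (fun a b => ((hξ (b, a) trivial).curry_left).differentiableAt) (fun x => by fun_prop)
    (fun a => (hpq a).1) (fun a => (hpq a).2) (by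
      intro b y x
      rw [sw_P, sw_Pb, sw_Px]
      have := heq2 x (y + -Ppoly k γ x b) b
      rw [show y + -Ppoly k γ x b + Ppoly k γ x b = y by ring] at this
      linear_combination -this)
  simp only [Nat.cast_sub (show n ≤ k by omega)] at r1 r2
  have hmnR : (m : ℝ) < n := by exact_mod_cast hmn
  have hnkR : (n : ℝ) + 1 ≤ k := by exact_mod_cast (by omega : n + 1 ≤ k)
  have hmR : (1 : ℝ) ≤ m := by exact_mod_cast hm'.1
  have hst : ∀ a, (∀ x, ξ (x, a) = x * deriv f a / k) ∧ ∀ b, β (a, b) = b * deriv f a / k := by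
    intro a
    set t := deriv (fun b => β (a, b)) 0 with ht
    set s := deriv (fun x => ξ (x, a)) 0 with hs
    have hξe : ∀ x, ξ (x, a) = x * ((deriv f a - t * m) / (k - m)) := by
      intro x
      have : (k : ℝ) - m ≠ 0 := by linarith
      field_simp
      linear_combination r1 x a
    have hs1 : s = (deriv f a - t * m) / (k - m) := by
      rw [hs, funext hξe]
      simp
    have hs2 : s * (k - m) + t * m = deriv f a := by
      have : (k : ℝ) - m ≠ 0 := by linarith
      rw [hs1]; field_simp; ring
    have hβe : ∀ b, β (a, b) = b * ((deriv f a - s * (k - n)) / n) := by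
      intro b
      have : (n : ℝ) ≠ 0 := by linarith
      field_simp
      linear_combination r2 b a
    have ht1 : t = (deriv f a - s * (k - n)) / n := by
      rw [ht, funext hβe]
      simp
    have ht2 : s * (k - n) + t * n = deriv f a := by
      have : (n : ℝ) ≠ 0 := by linarith
      rw [eq_div_iff this] at ht1
      linear_combination ht1
    have hst : s = t := by
      have : (n : ℝ) - m ≠ 0 := by linarith
      apply mul_right_cancel₀ this
      linear_combination hs2 - ht2
    have htk : t = deriv f a / k := by
      rw [hst] at hs2
      field_simp
      linear_combination hs2
    refine ⟨fun x => ?_, fun b => ?_⟩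
    · rw [hξe, ← hs1, hst, htk]; ring
    · rw [hβe, ← ht1, htk]; ring
  have q1 := step3 k (by omega) γ m hm hγm hlo f hfa (by
    intro x a b
    have := heq2 x a b
    rwa [(hst _).1, (hst _).2] at this)
  have q2 := step3 k (by omega) (sw k γ) (k - n) hnk hswn hswlo f hfa (by
    intro b y x
    rw [sw_P, sw_Pb, sw_Px]
    have := heq2 x (y + -Ppoly k γ x b) b
    rw [show y + -Ppoly k γ x b + Ppoly k γ x b = y by ring, (hst _).1, (hst _).2] at this
    linear_combination -this)
  have hdd : ∀ a, deriv (deriv f) a = 0 := by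
    intro a
    have e1 := q1 a
    have e2 := q2 a
    rw [Nat.cast_sub (show n ≤ k by omega)] at e2
    have : 2 * ((n : ℝ) - m) ≠ 0 := by linarith
    apply mul_right_cancel₀ this
    linear_combination e1 + e2
  have hd : ∀ a, deriv f a = deriv f 0 := fun a =>
    is_const_of_deriv_eq_zero (fun a => (hfa a).deriv.differentiableAt) hdd a 0
  have haff : ∀ a, f a = f 0 + deriv f 0 * a := by
    intro a
    have hh : Differentiable ℝ (fun a => f a - deriv f 0 * a) := by fun_prop
    have := is_const_of_deriv_eq_zero hh (by
      intro x
      have h5 : HasDerivAt (fun a => f a - deriv f 0 * a) (deriv f x - deriv f 0 * 1) x :=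
        (hfd x).hasDerivAt.sub ((hasDerivAt_id x).const_mul _)
      rw [h5.deriv, hd x]; ring) a 0
    linarith
  refine ⟨deriv f 0 / k, f 0, fun s t => ⟨?_, ?_, ?_, ?_⟩⟩
  · rw [(hst t).1, hd]; ring
  · rw [hηf, haff]; field_simp
  · rw [hαf, haff]; field_simp
  · rw [(hst s).2, hd]; ring

/-- for `k > 2` and `P(x,b) = ∑_{i=1}^{k-1} γᵢ bⁱ x^{k-i}` with at
least two nonzero `γᵢ` and not of the form `γᵢ = C(k,i) δ νⁱ`, the Lie algebra
`𝒜(S)` of infinitesimal multicontact automorphisms of `S = {y = a + P(x,b)}` is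
exactly the 2-dimensional span of `V₋ₖ = ∂_a + ∂_y` and
`V₀ = x∂_x + ky∂_y + ka∂_a + b∂_b`, with `[V₀, V₋ₖ] = −k V₋ₖ`. -/
theorem stmt_12
    (k : ℕ) (hk : 2 < k) (γ : ℕ → ℝ)
    (h2 : ∃ i ∈ Finset.Icc 1 (k - 1), ∃ j ∈ Finset.Icc 1 (k - 1),
      i ≠ j ∧ γ i ≠ 0 ∧ γ j ≠ 0)
    (hnotbin : ¬ ∃ δ ν : ℝ, ∀ i ∈ Finset.Icc 1 (k - 1),
      γ i = (k.choose i : ℝ) * δ * ν ^ i)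
    (W : Fin 2 → ((ℝ × ℝ × ℝ × ℝ) → ℝ × ℝ × ℝ × ℝ))
    (hW : W = ![fun _ => ((0 : ℝ), (1 : ℝ), (1 : ℝ), (0 : ℝ)),
      fun q => (q.1, (k : ℝ) * q.2.1, (k : ℝ) * q.2.2.1, q.2.2.2)]) :
    LinearIndependent ℝ W ∧
    (VFbracket (W 1) (W 0) = fun q => (-(k : ℝ)) • W 0 q) ∧
    ∀ ξ η α β : ℝ × ℝ → ℝ,
      AnalyticOnNhd ℝ ξ Set.univ → AnalyticOnNhd ℝ η Set.univ →
      AnalyticOnNhd ℝ α Set.univ → AnalyticOnNhd ℝ β Set.univ →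
      (TangentVF (Ppoly k γ) ξ η α β ↔
        ∃ c : Fin 2 → ℝ,
          (fun q : ℝ × ℝ × ℝ × ℝ =>
              ((ξ (q.1, q.2.1), η (q.1, q.2.1),
                α (q.2.2.1, q.2.2.2), β (q.2.2.1, q.2.2.2)) : ℝ × ℝ × ℝ × ℝ))
            = fun q => ∑ i, c i • W i q) := by
  subst hW
  have hk0 : (k : ℝ) ≠ 0 := by positivity
  refine ⟨?_, ?_, ?_⟩
  · rw [LinearIndependent.pair_iff]
    intro s t h
    have h1 := congrFun h (0, 0, 0, 0)
    have h3 := congrFun h (1, 0, 0, 0)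
    simp at h1 h3
    exact ⟨h1, h3.1⟩
  · funext q
    set L : (ℝ × ℝ × ℝ × ℝ) →L[ℝ] (ℝ × ℝ × ℝ × ℝ) :=
      (ContinuousLinearMap.fst ℝ ℝ (ℝ × ℝ × ℝ)).prod
        (((k : ℝ) • (ContinuousLinearMap.fst ℝ ℝ (ℝ × ℝ)).comp
            (ContinuousLinearMap.snd ℝ ℝ (ℝ × ℝ × ℝ))).prod
        (((k : ℝ) • ((ContinuousLinearMap.fst ℝ ℝ ℝ).comp
            (ContinuousLinearMap.snd ℝ ℝ (ℝ × ℝ))).comp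
            (ContinuousLinearMap.snd ℝ ℝ (ℝ × ℝ × ℝ))).prod
        (((ContinuousLinearMap.snd ℝ ℝ ℝ).comp
            (ContinuousLinearMap.snd ℝ ℝ (ℝ × ℝ))).comp
            (ContinuousLinearMap.snd ℝ ℝ (ℝ × ℝ × ℝ))))) with hL
    have hc : HasFDerivAt (fun q : ℝ × ℝ × ℝ × ℝ =>
        (q.1, (k : ℝ) * q.2.1, (k : ℝ) * q.2.2.1, q.2.2.2)) L q := L.hasFDerivAt
    have hL1 : L (0, 1, 1, 0) = (0, (k : ℝ), (k : ℝ), 0) := by simp [hL]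
    simp [VFbracket, hc.fderiv, hL1]
  · intro ξ η α β hξ hη hα hβ
    constructor
    · intro hT
      obtain ⟨c, d, h⟩ := forward k hk γ h2 hnotbin ξ η α β hξ hα hβ hT
      refine ⟨![d, c], ?_⟩
      funext q
      obtain ⟨x, y, a, b⟩ := q
      simp [Fin.sum_univ_two, (h x y).1, (h x y).2.1, (h a b).2.2.1, (h a b).2.2.2]
    · rintro ⟨c, h⟩ x a b
      have h1 := congrFun h (x, a + Ppoly k γ x b, a, b)
      simp [Fin.sum_univ_two] at h1
      obtain ⟨e1, e2, e3, e4⟩ := h1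
      rw [e1, e2, e3, e4, deriv_Pb, deriv_Px]
      linear_combination c 1 * euler_P k γ x b
end
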